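/- arXiv:2508.11241 — 4 statements merged into one kernel-verified Lean document; each statement's English description precedes it below -/
import Mathlib

section
/- Fix N ≥ 1, initial data θ₁⁰,…,θ_N⁰, ω₁⁰,…,ω_N⁰ ∈ ℝ, natural frequencies ν₁,…,ν_N ∈ ℝ, κ > 0, and m > 0. Let θᵢ(m,t) denote the solution of the inertial Kuramoto model with these data, and θᵢ(0,t) the solution of the first-order Kuramoto model with initial data θ₁⁰,…,θ_N⁰. Then for every t ≥ 0, max_{i}|θᵢ(m,t) − θᵢ(0,t)| ≤ m · |(max_i(ωᵢ⁰−νᵢ) + min_i(ωᵢ⁰−νᵢ))/2| · (1 − e^{−t/m}) + [m(D(Ω⁰−V) + 2κ)/(2√(1+8mκ))] · e^{−t/(2m)} · (e^{√(1+8mκ) t/(2m)} − e^{−√(1+8mκ) t/(2m)}), where D(Ω⁰−V) = max_{i,j}|(ωᵢ⁰−νᵢ) − (ωⱼ⁰−νⱼ)|. -/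
open Filter Topology MeasureTheory intervalIntegral

noncomputable section

/-- A global smooth solution of the inertial Kuramoto model
`m θ̈ᵢ + θ̇ᵢ = νᵢ + (κ/N) ∑ⱼ sin(θⱼ - θᵢ)` with initial data `θᵢ(0) = θ0 i`,
`θ̇ᵢ(0) = ω0 i`. -/
def IsInertialSol (N : ℕ) (m κ : ℝ) (ν θ0 ω0 : Fin N → ℝ) (θ : Fin N → ℝ → ℝ) : Prop :=
  (∀ i, ContDiff ℝ (⊤ : ℕ∞) (θ i)) ∧
  (∀ i, θ i 0 = θ0 i) ∧
  (∀ i, deriv (θ i) 0 = ω0 i) ∧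
  (∀ i, ∀ t : ℝ, 0 ≤ t →
    m * deriv (deriv (θ i)) t + deriv (θ i) t
      = ν i + (κ / N) * ∑ j, Real.sin (θ j t - θ i t))

/-- A global smooth solution of the first-order Kuramoto model
`θ̇ᵢ = νᵢ + (κ/N) ∑ⱼ sin(θⱼ - θᵢ)` with initial data `θᵢ(0) = θ0 i`. -/
def IsFirstOrderSol (N : ℕ) (κ : ℝ) (ν θ0 : Fin N → ℝ) (θ : Fin N → ℝ → ℝ) : Prop :=
  (∀ i, ContDiff ℝ (⊤ : ℕ∞) (θ i)) ∧
  (∀ i, θ i 0 = θ0 i) ∧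
  (∀ i, ∀ t : ℝ, 0 ≤ t →
    deriv (θ i) t = ν i + (κ / N) * ∑ j, Real.sin (θ j t - θ i t))

lemma kura_bound {f f' B B' : ℝ → ℝ} {T : ℝ}
    (hf : ∀ t, 0 ≤ t → HasDerivAt f (f' t) t) (hB : ∀ t, HasDerivAt B (B' t) t)
    (h0 : |f 0| ≤ B 0) (hle : ∀ t, 0 ≤ t → t ≤ T → |f' t| ≤ B' t) :
    ∀ t, 0 ≤ t → t ≤ T → |f t| ≤ B t := by
  intro t ht htT
  have := image_norm_le_of_norm_deriv_right_le_deriv_boundary (f := f) (f' := f') (a := 0) (b := T)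
    (B := B) (B' := B')
    (fun x hx => (hf x hx.1).continuousAt.continuousWithinAt)
    (fun x hx => (hf x hx.1).hasDerivWithinAt) (by simpa using h0) hB
    (fun x hx => by simpa using hle x hx.1 hx.2.le) ⟨ht, htT⟩
  simpa using this

lemma kura_step {ι : Type*} (v H H' R : ι → ℝ → ℝ) (y h y' : ℝ → ℝ) (m κ S T : ℝ)
    (hm : 0 < m) (hκ : 0 < κ) (hS : 0 ≤ S)
    (hv : ∀ i t, 0 ≤ t → HasDerivAt (v i) ((H i t - R i t - v i t) / m) t)
    (hH : ∀ i t, 0 ≤ t → HasDerivAt (H i) (H' i t) t)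
    (hR : ∀ i t, |R i t| ≤ m * κ)
    (hH' : ∀ i t B, 0 ≤ t → (∀ j, |v j t| ≤ B) → |H' i t| ≤ 2 * κ * B)
    (hv0 : ∀ i, v i 0 = 0) (hy0 : y 0 = 0)
    (hH0 : ∀ i, |H i 0| + m * κ ≤ h 0)
    (hy : ∀ t, HasDerivAt y (y' t) t) (hyh : ∀ t, m * y' t + y t = h t)
    (hh : ∀ t, HasDerivAt h (2 * κ * y t) t)
    (hb : ∀ i t, 0 ≤ t → t ≤ T → |v i t| ≤ y t + S * Real.exp (4 * κ * t)) :
    ∀ i t, 0 ≤ t → t ≤ T → |v i t| ≤ y t + S / 2 * Real.exp (4 * κ * t) := by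
  intro i
  have hE : ∀ t, HasDerivAt (fun t => Real.exp (4 * κ * t)) (4 * κ * Real.exp (4 * κ * t)) t := by
    intro t
    have := ((hasDerivAt_id t).const_mul (4 * κ)).exp
    simpa [mul_comm] using this
  have hF : ∀ t, HasDerivAt (fun t => Real.exp (t / m)) (Real.exp (t / m) / m) t := by
    intro t
    have := ((hasDerivAt_id t).div_const m).exp
    simpa [div_eq_mul_inv] using this
  have h1 : ∀ t, 0 ≤ t → t ≤ T → |H i t| ≤ h t - m * κ + S / 2 * Real.exp (4 * κ * t) := by
    refine kura_bound (hH i) (B' := fun t => 2 * κ * y t + S / 2 * (4 * κ * Real.exp (4 * κ * t)))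
      (fun t => ((hh t).sub_const _).add ((hE t).const_mul _)) ?_ ?_
    · have := hH0 i
      simp
      linarith
    · intro t h0 hT
      have := hH' i t _ h0 (fun j => hb j t h0 hT)
      linarith
  have h2 : ∀ t, 0 ≤ t → t ≤ T → |Real.exp (t / m) * v i t| ≤
      Real.exp (t / m) * (y t + S / 2 * Real.exp (4 * κ * t)) := by
    refine kura_bound (fun t ht => (hF t).mul (hv i t ht))
      (fun t => (hF t).mul ((hy t).add ((hE t).const_mul _))) ?_ ?_
    · simp [hv0, hy0]; linarith
    · intro t h0 hT
      have e1 : Real.exp (t / m) / m * v i t + Real.exp (t / m) * ((H i t - R i t - v i t) / m)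
        = Real.exp (t / m) / m * (H i t - R i t) := by ring
      have e2 : Real.exp (t / m) / m * (y t + S / 2 * Real.exp (4 * κ * t)) +
          Real.exp (t / m) * (y' t + S / 2 * (4 * κ * Real.exp (4 * κ * t)))
        = Real.exp (t / m) / m * (h t + S / 2 * Real.exp (4 * κ * t)
            + m * (S / 2 * (4 * κ * Real.exp (4 * κ * t)))) := by
        rw [← hyh]; field_simp; ring
      have hp : 0 < Real.exp (t / m) / m := by positivity
      have hp2 : 0 ≤ m * (S / 2 * (4 * κ * Real.exp (4 * κ * t))) := by positivity
      rw [e1, e2, abs_mul, abs_of_pos hp]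
      apply mul_le_mul_of_nonneg_left _ hp.le
      have := h1 t h0 hT
      have := hR i t
      have := abs_sub (H i t) (R i t)
      linarith
  intro t h0 hT
  have := h2 t h0 hT
  rw [abs_mul, abs_of_pos (Real.exp_pos _)] at this
  exact le_of_mul_le_mul_left this (Real.exp_pos _)

lemma kura_core {ι : Type*} [Fintype ι] (v H H' R : ι → ℝ → ℝ) (y h y' : ℝ → ℝ) (m κ : ℝ)
    (hm : 0 < m) (hκ : 0 < κ)
    (hv : ∀ i t, 0 ≤ t → HasDerivAt (v i) ((H i t - R i t - v i t) / m) t)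
    (hH : ∀ i t, 0 ≤ t → HasDerivAt (H i) (H' i t) t)
    (hR : ∀ i t, |R i t| ≤ m * κ)
    (hH' : ∀ i t B, 0 ≤ t → (∀ j, |v j t| ≤ B) → |H' i t| ≤ 2 * κ * B)
    (hv0 : ∀ i, v i 0 = 0) (hy0 : y 0 = 0)
    (hH0 : ∀ i, |H i 0| + m * κ ≤ h 0)
    (hy : ∀ t, HasDerivAt y (y' t) t) (hyh : ∀ t, m * y' t + y t = h t)
    (hh : ∀ t, HasDerivAt h (2 * κ * y t) t) :
    ∀ i t, 0 ≤ t → |v i t| ≤ y t := by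
  intro i T hT
  have hex : ∀ i, ∃ C, ∀ t ∈ Set.Icc 0 T, ‖|v i t| - y t‖ ≤ C := by
    intro i
    refine isCompact_Icc.exists_bound_of_continuousOn ?_
    intro t ht
    exact ((hv i t ht.1).continuousAt.abs.sub (hy t).continuousAt).continuousWithinAt
  choose C hC using hex
  set S := ∑ i, |C i| with hSdef
  have hS : 0 ≤ S := Finset.sum_nonneg fun _ _ => abs_nonneg _
  have hn : ∀ n : ℕ, ∀ i t, 0 ≤ t → t ≤ T →
      |v i t| ≤ y t + S / 2 ^ n * Real.exp (4 * κ * t) := by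
    intro n
    induction n with
    | zero =>
      intro i t h0 hT
      have a1 := hC i t ⟨h0, hT⟩
      have a2 : |C i| ≤ S :=
        Finset.single_le_sum (f := fun i => |C i|) (fun _ _ => abs_nonneg _) (Finset.mem_univ i)
      have a3 : 1 ≤ Real.exp (4 * κ * t) := Real.one_le_exp (by positivity)
      have a4 := le_abs_self (C i)
      have a5 : |v i t| - y t ≤ C i := (le_abs_self _).trans a1
      have : S ≤ S * Real.exp (4 * κ * t) := le_mul_of_one_le_right hS a3
      simp
      linarith
    | succ n ih =>
      have := kura_step v H H' R y h y' m κ (S / 2 ^ n) T hm hκ (by positivity)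
        hv hH hR hH' hv0 hy0 hH0 hy hyh hh ih
      rw [pow_succ, ← div_div]
      exact this
  have hlim : Tendsto (fun n : ℕ => y T + S / 2 ^ n * Real.exp (4 * κ * T)) atTop
      (𝓝 (y T + 0 * Real.exp (4 * κ * T))) := by
    refine tendsto_const_nhds.add (Tendsto.mul_const _ ?_)
    exact tendsto_const_nhds.div_atTop (tendsto_pow_atTop_atTop_of_one_lt (by norm_num))
  have := ge_of_tendsto' hlim (fun n => hn n i T hT le_rfl)
  simpa using this

lemma kura_sin (a b : ℝ) : |Real.sin a - Real.sin b| ≤ |a - b| := by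
  have := Real.abs_sin_sub_sin_le a b
  exact this

/-- Inequality (B.2): sharpened `C⁰` bound (in the sup norm) for the zero inertia limit. -/
theorem stmt4 (N : ℕ) (hN : 1 ≤ N) (θ0 ω0 ν : Fin N → ℝ) (κ m : ℝ)
    (hκ : 0 < κ) (hm : 0 < m)
    (θm θz : Fin N → ℝ → ℝ)
    (hθm : IsInertialSol N m κ ν θ0 ω0 θm)
    (hθz : IsFirstOrderSol N κ ν θ0 θz) :
    ∀ t : ℝ, 0 ≤ t → ∀ i,
      |θm i t - θz i t| ≤
        m * |((⨆ i, (ω0 i - ν i)) + (⨅ i, (ω0 i - ν i))) / 2| * (1 - Real.exp (-t / m)) +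
        m * ((⨆ i, ⨆ j, |(ω0 i - ν i) - (ω0 j - ν j)|) + 2 * κ) /
            (2 * Real.sqrt (1 + 8 * m * κ)) *
          Real.exp (-t / (2 * m)) *
          (Real.exp (Real.sqrt (1 + 8 * m * κ) * t / (2 * m)) -
            Real.exp (-(Real.sqrt (1 + 8 * m * κ) * t / (2 * m)))) := by
  obtain ⟨cm, m0, mω, meq⟩ := hθm
  obtain ⟨cz, z0, zeq⟩ := hθz
  have hNr : (0 : ℝ) < N := by exact_mod_cast hN
  set c := ((⨆ i, (ω0 i - ν i)) + (⨅ i, (ω0 i - ν i))) / 2 with hc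
  set D := (⨆ i, ⨆ j, |(ω0 i - ν i) - (ω0 j - ν j)|) with hD
  have hDle : ∀ i j, (ω0 i - ν i) - (ω0 j - ν j) ≤ D := by
    intro i j
    refine (le_abs_self _).trans ?_
    refine le_trans ?_ (le_ciSup (f := fun i => ⨆ j, |(ω0 i - ν i) - (ω0 j - ν j)|)
      (Set.finite_range _).bddAbove i)
    exact le_ciSup (f := fun j => |(ω0 i - ν i) - (ω0 j - ν j)|) (Set.finite_range _).bddAbove j
  have hca : ∀ i, |ω0 i - ν i - c| ≤ D / 2 := by
    intro i
    haveI : Nonempty (Fin N) := ⟨i⟩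
    have s1 : ω0 i - ν i ≤ ⨆ i, (ω0 i - ν i) :=
      le_ciSup (f := fun i => ω0 i - ν i) (Set.finite_range _).bddAbove i
    have s2 : (⨅ i, (ω0 i - ν i)) ≤ ω0 i - ν i :=
      ciInf_le (f := fun i => ω0 i - ν i) (Set.finite_range _).bddBelow i
    have s3 : (⨆ i, (ω0 i - ν i)) ≤ ω0 i - ν i + D :=
      ciSup_le fun j => by linarith [hDle j i]
    have s4 : ω0 i - ν i - D ≤ (⨅ i, (ω0 i - ν i)) :=
      le_ciInf fun j => by linarith [hDle i j]
    rw [abs_le]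
    constructor <;> linarith
  set r := Real.sqrt (1 + 8 * m * κ) with hr
  have hr2 : r ^ 2 = 1 + 8 * m * κ := Real.sq_sqrt (by positivity)
  have hrpos : 0 < r := Real.sqrt_pos.2 (by positivity)
  set A := m * (D + 2 * κ) / (2 * r) with hA
  obtain ⟨α, hα⟩ : ∃ α, α = (-1 + r) / (2 * m) := ⟨_, rfl⟩
  obtain ⟨β, hβ⟩ : ∃ β, β = (-1 - r) / (2 * m) := ⟨_, rfl⟩
  have hα2 : α * (m * α + 1) = 2 * κ := by
    rw [hα]; field_simp; linear_combination hr2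
  have hβ2 : β * (m * β + 1) = 2 * κ := by
    rw [hβ]; field_simp; linear_combination hr2
  have hexp : ∀ a t : ℝ, HasDerivAt (fun t => Real.exp (a * t)) (a * Real.exp (a * t)) t := by
    intro a t
    have := ((hasDerivAt_id t).const_mul a).exp
    simpa [mul_comm] using this
  have dm : ∀ i t, HasDerivAt (θm i) (deriv (θm i) t) t := fun i t =>
    ((cm i).differentiable (by simp) t).hasDerivAt
  have dm2 : ∀ i t, HasDerivAt (deriv (θm i)) (deriv (deriv (θm i)) t) t := fun i t =>
    (((contDiff_infty_iff_deriv.1 (cm i)).2).differentiable (by simp) t).hasDerivAt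
  have dz : ∀ i t, HasDerivAt (θz i) (deriv (θz i) t) t := fun i t =>
    ((cz i).differentiable (by simp) t).hasDerivAt
  have key := kura_core
    (v := fun i t => θm i t - θz i t - c * m * (1 - Real.exp ((-1 / m) * t)))
    (H := fun i t => m * deriv (θm i) t + θm i t - θz i t - (m * ν i + c * m))
    (H' := fun i t => m * deriv (deriv (θm i)) t + deriv (θm i) t - deriv (θz i) t)
    (R := fun i t => m * ((κ / N) * ∑ j, Real.sin (θz j t - θz i t)))
    (y := fun t => A * (Real.exp (α * t) - Real.exp (β * t)))
    (h := fun t => A * ((m * α + 1) * Real.exp (α * t) - (m * β + 1) * Real.exp (β * t)))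
    (y' := fun t => A * (α * Real.exp (α * t) - β * Real.exp (β * t)))
    (m := m) (κ := κ) hm hκ ?_ ?_ ?_ ?_ ?_ ?_ ?_ ?_ ?_ ?_
  · intro t ht i
    have k := key i t ht
    have ea : Real.exp (-t / (2 * m)) * (Real.exp (r * t / (2 * m)) - Real.exp (-(r * t / (2 * m))))
        = Real.exp (α * t) - Real.exp (β * t) := by
      rw [mul_sub, ← Real.exp_add, ← Real.exp_add, hα, hβ]
      congr 2 <;> ring
    rw [mul_assoc A, ea]
    have eb : -t / m = (-1 / m) * t := by ring
    rw [eb]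
    have ec : Real.exp ((-1 / m) * t) ≤ 1 := by
      rw [← eb]
      apply Real.exp_le_one_iff.2
      exact div_nonpos_of_nonpos_of_nonneg (by linarith) hm.le
    have ed : |c * m * (1 - Real.exp ((-1 / m) * t))|
        = m * |c| * (1 - Real.exp ((-1 / m) * t)) := by
      rw [abs_mul, abs_mul, abs_of_pos hm, abs_of_nonneg (sub_nonneg.2 ec)]; ring
    rw [← ed]
    have := abs_add_le (θm i t - θz i t - c * m * (1 - Real.exp ((-1 / m) * t)))
      (c * m * (1 - Real.exp ((-1 / m) * t)))
    rw [sub_add_cancel] at this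
    linarith
  · intro i t ht
    refine (((dm i t).sub (dz i t)).sub
      (((hexp (-1 / m) t).const_sub 1).const_mul (c * m))).congr_deriv ?_
    have := zeq i t ht
    have e : (κ / N) * ∑ j, Real.sin (θz j t - θz i t) = deriv (θz i) t - ν i := by linarith
    simp only [e]
    field_simp
    ring
  · intro i t ht
    exact ((((dm2 i t).const_mul m).add (dm i t)).sub (dz i t)).sub_const _
  · intro i t
    rw [abs_mul, abs_mul, abs_of_pos hm, abs_of_pos (div_pos hκ hNr)]
    have : |∑ j, Real.sin (θz j t - θz i t)| ≤ N := by
      refine (Finset.abs_sum_le_sum_abs _ _).trans ?_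
      refine (Finset.sum_le_sum (fun j _ => Real.abs_sin_le_one _)).trans ?_
      simp
    calc m * (κ / N * |∑ j, Real.sin (θz j t - θz i t)|) ≤ m * (κ / N * N) := by gcongr
      _ = m * κ := by field_simp
  · intro i t B ht hB
    skip
    have e : m * deriv (deriv (θm i)) t + deriv (θm i) t - deriv (θz i) t
        = κ / N * ∑ j, (Real.sin (θm j t - θm i t) - Real.sin (θz j t - θz i t)) := by
      rw [meq i t ht, zeq i t ht, Finset.sum_sub_distrib]; ring
    rw [e, abs_mul, abs_of_pos (div_pos hκ hNr)]
    have : |∑ j, (Real.sin (θm j t - θm i t) - Real.sin (θz j t - θz i t))| ≤ N * (2 * B) := by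
      refine (Finset.abs_sum_le_sum_abs _ _).trans ?_
      refine (Finset.sum_le_sum (g := fun _ => 2 * B) (fun j _ => ?_)).trans ?_
      · refine (kura_sin _ _).trans ?_
        have b1 := abs_le.1 (hB j)
        have b2 := abs_le.1 (hB i)
        rw [abs_le]
        constructor <;> linarith [b1.1, b1.2, b2.1, b2.2]
      · simp
    calc _ ≤ κ / N * (N * (2 * B)) := by gcongr
      _ = 2 * κ * B := by field_simp
  · intro i
    simp [m0, z0]
  · simp
  · intro i
    have e1 : m * deriv (θm i) 0 + θm i 0 - θz i 0 - (m * ν i + c * m)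
        = m * (ω0 i - ν i - c) := by rw [m0, z0, mω]; ring
    simp only [e1, mul_zero, Real.exp_zero, mul_one]
    rw [abs_mul, abs_of_pos hm]
    have e2 : A * (m * α + 1 - (m * β + 1)) = m * (D / 2) + m * κ := by
      rw [hA, hα, hβ]; field_simp; ring
    rw [e2]
    have := mul_le_mul_of_nonneg_left (hca i) hm.le
    linarith
  · intro t
    exact ((hexp α t).sub (hexp β t)).const_mul A
  · intro t
    ring
  · intro t
    refine ((((hexp α t).const_mul (m * α + 1)).sub
      ((hexp β t).const_mul (m * β + 1))).const_mul A).congr_deriv ?_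
    linear_combination A * Real.exp (α * t) * hα2 - A * Real.exp (β * t) * hβ2
end
end

section
/- Fix N ≥ 1, initial data θ₁⁰,…,θ_N⁰, ω₁⁰,…,ω_N⁰ ∈ ℝ, natural frequencies ν₁,…,ν_N ∈ ℝ, κ > 0, and m > 0. Let θᵢ(m,t) denote the solution of the inertial Kuramoto model with these data, and θᵢ(0,t) the solution of the first-order Kuramoto model with initial data θ₁⁰,…,θ_N⁰. Then for every t ≥ 0, max_{i,j}|(θ̇ᵢ(m,t)−θ̇ᵢ(0,t)) − (θ̇ⱼ(m,t)−θ̇ⱼ(0,t))| ≤ (D(Ω⁰−V)+2κ) e^{−t/m} + 2mκ(D(V)+2κ)(1−e^{−t/m}) + [4mκ(D(Ω⁰−V)+2κ) / (√(1+8mκ)(1+√(1+8mκ)))] · e^{(−1+√(1+8mκ)) t/(2m)}, where D(V) = max_{i,j}|νᵢ−νⱼ| and D(Ω⁰−V) = max_{i,j}|(ωᵢ⁰−νᵢ) − (ωⱼ⁰−νⱼ)|. -/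
open Filter Topology MeasureTheory intervalIntegral

noncomputable section

/-- scalar comparison -/
lemma cmp_aux (a b T : ℝ) (ha : 0 < a) (F F' G G' : ℝ → ℝ)
    (hF : ∀ t, HasDerivAt F (F' t) t) (hG : ∀ t, HasDerivAt G (G' t) t)
    (h0 : F 0 ≤ G 0)
    (h : ∀ t, 0 ≤ t → t ≤ T → a * F' t + b * F t ≤ a * G' t + b * G t) :
    ∀ t, 0 ≤ t → t ≤ T → F t ≤ G t := by
  intro t ht htT
  have hE : ∀ s, HasDerivAt (fun s => Real.exp (b / a * s)) (Real.exp (b / a * s) * (b / a)) s := by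
    intro s
    have := ((hasDerivAt_id s).const_mul (b / a)).exp
    simpa using this
  have hH : ∀ s, HasDerivAt (fun s => (G s - F s) * Real.exp (b / a * s))
      ((G' s - F' s) * Real.exp (b / a * s) + (G s - F s) * (Real.exp (b / a * s) * (b / a))) s :=
    fun s => ((hG s).sub (hF s)).mul (hE s)
  have hmono : MonotoneOn (fun s => (G s - F s) * Real.exp (b / a * s)) (Set.Icc 0 T) := by
    apply monotoneOn_of_deriv_nonneg (convex_Icc 0 T)
    · exact fun s _ => (hH s).continuousAt.continuousWithinAt
    · exact fun s _ => (hH s).differentiableAt.differentiableWithinAt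
    · intro s hs
      rw [interior_Icc] at hs
      rw [(hH s).deriv]
      have h1 := h s hs.1.le hs.2.le
      have h2 : (G' s - F' s) * Real.exp (b / a * s) + (G s - F s) * (Real.exp (b / a * s) * (b / a))
          = Real.exp (b / a * s) / a * ((a * G' s + b * G s) - (a * F' s + b * F s)) := by
        field_simp
        ring
      rw [h2]
      have := Real.exp_pos (b / a * s)
      apply mul_nonneg (by positivity) (by linarith)
  have h3 := hmono (Set.mem_Icc.2 ⟨le_refl _, ht.trans htT⟩) (Set.mem_Icc.2 ⟨ht, htT⟩) ht
  simp only [mul_zero, Real.exp_zero, mul_one] at h3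
  have h4 : 0 ≤ (G t - F t) * Real.exp (b / a * t) := by linarith
  have h5 := nonneg_of_mul_nonneg_left h4 (Real.exp_pos _)
  linarith

lemma cmp_abs (a b T : ℝ) (ha : 0 < a) (F F' G G' : ℝ → ℝ)
    (hF : ∀ t, HasDerivAt F (F' t) t) (hG : ∀ t, HasDerivAt G (G' t) t)
    (h0 : |F 0| ≤ G 0)
    (h : ∀ t, 0 ≤ t → t ≤ T → |a * F' t + b * F t| ≤ a * G' t + b * G t) :
    ∀ t, 0 ≤ t → t ≤ T → |F t| ≤ G t := by
  intro t ht htT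
  rw [abs_le']
  constructor
  · exact cmp_aux a b T ha F F' G G' hF hG ((le_abs_self _).trans h0)
      (fun s hs hsT => (le_abs_self _).trans (h s hs hsT)) t ht htT
  · refine cmp_aux a b T ha (fun s => - F s) (fun s => - F' s) G G' (fun s => (hF s).neg) hG
      ((neg_le_abs _).trans h0) (fun s hs hsT => ?_) t ht htT
    have := (neg_le_abs _).trans (h s hs hsT)
    linarith

lemma avg_bound (N : ℕ) (hN : 1 ≤ N) (κ : ℝ) (hκ : 0 < κ) (f : Fin N → ℝ) (d : ℝ)
    (h : ∀ j, |f j| ≤ d) : |(κ / N) * ∑ j, f j| ≤ κ * d := by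
  have hN' : (0 : ℝ) < N := by exact_mod_cast hN
  rw [abs_mul, abs_of_pos (div_pos hκ hN')]
  have h1 : |∑ j, f j| ≤ N * d := by
    refine (Finset.abs_sum_le_sum_abs _ _).trans ?_
    refine (Finset.sum_le_sum (fun j _ => h j)).trans ?_
    simp
  calc κ / N * |∑ j, f j| ≤ κ / N * (N * d) := by gcongr
    _ = κ * d := by field_simp

lemma sin_lip (x y : ℝ) : |Real.sin x - Real.sin y| ≤ |x - y| := by
  rw [Real.sin_sub_sin, abs_mul, abs_mul]
  have h1 : |Real.sin ((x - y) / 2)| ≤ |(x - y) / 2| := Real.abs_sin_le_abs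
  have h2 := Real.abs_cos_le_one ((x + y) / 2)
  have h3 : |(x - y) / 2| = |x - y| / 2 := by rw [abs_div]; norm_num
  have : |(2 : ℝ)| = 2 := by norm_num
  rw [this]
  nlinarith [abs_nonneg (Real.sin ((x - y) / 2)), abs_nonneg (Real.cos ((x + y) / 2))]

lemma le_dsup (N : ℕ) (f : Fin N → Fin N → ℝ) (i j : Fin N) : f i j ≤ ⨆ i, ⨆ j, f i j :=
  (le_ciSup (f := fun j => f i j) (Finite.bddAbove_range _) j).trans
    (le_ciSup (f := fun i => ⨆ j, f i j) (Finite.bddAbove_range _) i)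

lemma hasDerivAt_cexp (c l t : ℝ) :
    HasDerivAt (fun s => c * Real.exp (l * s)) (c * (l * Real.exp (l * t))) t := by
  have := (((hasDerivAt_id t).const_mul l).exp).const_mul c
  simp only [id, mul_one] at this
  rw [mul_comm l]
  exact this

set_option maxHeartbeats 2000000 in
/-- Inequality (B.5): sharpened `C¹` diameter bound for the zero inertia limit. -/
theorem stmt7 (N : ℕ) (hN : 1 ≤ N) (θ0 ω0 ν : Fin N → ℝ) (κ m : ℝ)
    (hκ : 0 < κ) (hm : 0 < m)
    (θm θz : Fin N → ℝ → ℝ)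
    (hθm : IsInertialSol N m κ ν θ0 ω0 θm)
    (hθz : IsFirstOrderSol N κ ν θ0 θz) :
    ∀ t : ℝ, 0 ≤ t → ∀ i j,
      |(deriv (θm i) t - deriv (θz i) t) - (deriv (θm j) t - deriv (θz j) t)| ≤
        ((⨆ i, ⨆ j, |(ω0 i - ν i) - (ω0 j - ν j)|) + 2 * κ) * Real.exp (-t / m) +
        2 * m * κ * ((⨆ i, ⨆ j, |ν i - ν j|) + 2 * κ) * (1 - Real.exp (-t / m)) +
        4 * m * κ * ((⨆ i, ⨆ j, |(ω0 i - ν i) - (ω0 j - ν j)|) + 2 * κ) /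
            (Real.sqrt (1 + 8 * m * κ) * (1 + Real.sqrt (1 + 8 * m * κ))) *
          Real.exp ((-1 + Real.sqrt (1 + 8 * m * κ)) * t / (2 * m)) := by
  obtain ⟨hc, hi0, hi1, hode⟩ := hθm
  obtain ⟨zc, zi0, zode⟩ := hθz
  set D : ℝ := ⨆ i, ⨆ j, |(ω0 i - ν i) - (ω0 j - ν j)| with hD
  set V : ℝ := ⨆ i, ⨆ j, |ν i - ν j| with hV
  have hDle : ∀ i j, |(ω0 i - ν i) - (ω0 j - ν j)| ≤ D :=
    fun i j => le_dsup N (fun i j => |(ω0 i - ν i) - (ω0 j - ν j)|) i j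
  have hVle : ∀ i j, |ν i - ν j| ≤ V := fun i j => le_dsup N (fun i j => |ν i - ν j|) i j
  set r : ℝ := Real.sqrt (1 + 8 * m * κ) with hr
  have hmκ : 0 < m * κ := mul_pos hm hκ
  have hr2 : r * r = 1 + 8 * m * κ := Real.mul_self_sqrt (by nlinarith)
  have hr0 : 0 ≤ r := Real.sqrt_nonneg _
  have hr1 : 1 ≤ r := by nlinarith
  have hrpos : 0 < r := by linarith
  obtain ⟨i0⟩ : Nonempty (Fin N) := ⟨⟨0, hN⟩⟩
  have hD0 : 0 ≤ D := (abs_nonneg _).trans (hDle i0 i0)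
  have hV0 : 0 ≤ V := (abs_nonneg _).trans (hVle i0 i0)
  set A : ℝ := D + 2 * κ with hA
  set B : ℝ := V + 2 * κ with hB
  have hA0 : 0 < A := by positivity
  have hB0 : 0 < B := by positivity
  -- exponents
  obtain ⟨l, hl⟩ : ∃ l : ℝ, l = (-1 + r) / (2 * m) := ⟨_, rfl⟩
  obtain ⟨μ, hμ⟩ : ∃ μ : ℝ, μ = (-1 - r) / (2 * m) := ⟨_, rfl⟩
  have hlr : m * l = (-1 + r) / 2 := by rw [hl]; field_simp
  have hμr : m * μ = (-1 - r) / 2 := by rw [hμ]; field_simp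
  have hl2 : m * l * l + l = 2 * κ := by
    have h1 : m * (m * l * l + l) = m * (2 * κ) := by
      have : m * (m * l * l + l) = (m * l) * (m * l) + m * l := by ring
      rw [this, hlr]; linear_combination hr2 / 4
    exact mul_left_cancel₀ hm.ne' h1
  have hμ2 : m * μ * μ + μ = 2 * κ := by
    have h1 : m * (m * μ * μ + μ) = m * (2 * κ) := by
      have : m * (m * μ * μ + μ) = (m * μ) * (m * μ) + m * μ := by ring
      rw [this, hμr]; linear_combination hr2 / 4
    exact mul_left_cancel₀ hm.ne' h1
  have hμl : μ ≤ l := by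
    have : m * μ ≤ m * l := by rw [hlr, hμr]; linarith
    exact le_of_mul_le_mul_left this hm
  obtain ⟨c, hcdef⟩ : ∃ c : ℝ, c = A * m / r := ⟨_, rfl⟩
  have hc0 : 0 < c := by rw [hcdef]; positivity
  have hcr : c * r = A * m := by rw [hcdef]; field_simp
  -- the majorants
  let X : ℝ → ℝ := fun s => c * Real.exp (l * s) - c * Real.exp (μ * s)
  let X' : ℝ → ℝ := fun s => c * (l * Real.exp (l * s)) - c * (μ * Real.exp (μ * s))
  let P : ℝ → ℝ := fun s => c * (m * l + 1) * Real.exp (l * s) - c * (m * μ + 1) * Real.exp (μ * s)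
  have hX : ∀ s, HasDerivAt X (X' s) s := fun s => (hasDerivAt_cexp c l s).sub (hasDerivAt_cexp c μ s)
  have hP : ∀ s, HasDerivAt P (2 * κ * X s) s := by
    intro s
    have h := (hasDerivAt_cexp (c * (m * l + 1)) l s).sub (hasDerivAt_cexp (c * (m * μ + 1)) μ s)
    refine h.congr_deriv ?_
    change _ = 2 * κ * (c * Real.exp (l * s) - c * Real.exp (μ * s))
    linear_combination (c * Real.exp (l * s)) * hl2 - (c * Real.exp (μ * s)) * hμ2
  have hXP : ∀ s, m * X' s + X s = P s := by
    intro s; simp only [X, X', P]; ring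
  have hX0 : X 0 = 0 := by simp [X]
  have hP0 : P 0 = m * A := by
    simp only [P, mul_zero, Real.exp_zero, mul_one]
    rw [hlr, hμr]; linear_combination hcr
  have hXnn : ∀ s, 0 ≤ s → 0 ≤ X s := by
    intro s hs
    have : Real.exp (μ * s) ≤ Real.exp (l * s) :=
      Real.exp_le_exp.2 (mul_le_mul_of_nonneg_right hμl hs)
    simp only [X]; nlinarith
  -- derivatives
  have dθ : ∀ i t, HasDerivAt (θm i) (deriv (θm i) t) t := fun i t =>
    ((hc i).differentiable (by simp)).differentiableAt.hasDerivAt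
  have dz : ∀ i t, HasDerivAt (θz i) (deriv (θz i) t) t := fun i t =>
    ((zc i).differentiable (by simp)).differentiableAt.hasDerivAt
  have dω : ∀ i t, HasDerivAt (deriv (θm i)) (deriv (deriv (θm i)) t) t := fun i t => by
    have h1 : ContDiff ℝ ((⊤ : ℕ∞) : WithTop ℕ∞) (deriv (θm i)) := by
      have := (contDiff_infty_iff_deriv (𝕜 := ℝ)).1 (hc i)
      exact this.2
    exact (h1.differentiable (by simp)).differentiableAt.hasDerivAt
  let S : (Fin N → ℝ → ℝ) → Fin N → ℝ → ℝ := fun θ i t => (κ / N) * ∑ j, Real.sin (θ j t - θ i t)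
  have hS : ∀ θ i t, |S θ i t| ≤ κ := by
    intro θ i t
    have := avg_bound N hN κ hκ (fun j => Real.sin (θ j t - θ i t)) 1 (fun j => Real.abs_sin_le_one _)
    simpa [S] using this
  have hSd : ∀ i t, HasDerivAt (S θz i)
      ((κ / N) * ∑ j, Real.cos (θz j t - θz i t) * (deriv (θz j) t - deriv (θz i) t)) t := by
    intro i t
    refine HasDerivAt.const_mul _ ?_
    exact HasDerivAt.fun_sum (fun j _ => ((dz j t).sub (dz i t)).sin)
  have hSlip : ∀ t d, (∀ i j, |(θm i t - θz i t) - (θm j t - θz j t)| ≤ d) →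
      ∀ i, |S θm i t - S θz i t| ≤ κ * d := by
    intro t d h i
    have := avg_bound N hN κ hκ
      (fun j => Real.sin (θm j t - θm i t) - Real.sin (θz j t - θz i t)) d (fun j => by
        refine (sin_lip _ _).trans ?_
        have h1 := h j i
        have h2 : (θm j t - θm i t) - (θz j t - θz i t)
          = (θm j t - θz j t) - (θm i t - θz i t) := by ring
        rw [h2]; exact h1)
    rw [Finset.sum_sub_distrib, mul_sub] at this
    exact this
  have abs4 : ∀ a b e : ℝ, |a| ≤ e → |b| ≤ e → |a - b| ≤ 2 * e := by
    intro a b e h1 h2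
    have := abs_sub a b
    linarith
  have hzdiff : ∀ t, 0 ≤ t → ∀ i j, |deriv (θz i) t - deriv (θz j) t| ≤ B := by
    intro t ht i j
    rw [zode i t ht, zode j t ht]
    have h1 := abs4 _ _ _ (hS θz i t) (hS θz j t)
    have h2 := hVle i j
    have h3 := abs_add_le (ν i - ν j) (S θz i t - S θz j t)
    have h4 : (ν i + (κ / N) * ∑ k, Real.sin (θz k t - θz i t))
        - (ν j + (κ / N) * ∑ k, Real.sin (θz k t - θz j t))
        = (ν i - ν j) + (S θz i t - S θz j t) := by simp only [S]; ring
    rw [h4]; linarith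
  have hodem : ∀ i t, 0 ≤ t → m * deriv (deriv (θm i)) t + deriv (θm i) t = ν i + S θm i t := hode
  have hodez : ∀ i t, 0 ≤ t → deriv (θz i) t = ν i + S θz i t := zode
  -- improvement step
  have step : ∀ T η : ℝ, 0 ≤ η →
      (∀ t, 0 ≤ t → t ≤ T → ∀ i j, |(θm i t - θz i t) - (θm j t - θz j t)|
        ≤ X t + η * Real.exp (4 * κ * t)) →
      (∀ t, 0 ≤ t → t ≤ T → ∀ i j, |(θm i t - θz i t) - (θm j t - θz j t)|
        ≤ X t + η / 2 * Real.exp (4 * κ * t)) := by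
    intro T η hη h
    -- bound for q
    have hq : ∀ i j t, 0 ≤ t → t ≤ T →
        |(m * (deriv (θm i) t - ν i) + (θm i t - θz i t))
          - (m * (deriv (θm j) t - ν j) + (θm j t - θz j t))|
        ≤ P t + (η / 2 * Real.exp (4 * κ * t)) - 2 * m * κ := by
      intro i j
      have dq : ∀ i t, HasDerivAt (fun t => m * (deriv (θm i) t - ν i) + (θm i t - θz i t))
          (m * deriv (deriv (θm i)) t + (deriv (θm i) t - deriv (θz i) t)) t := fun i t =>
        (((dω i t).sub_const (ν i)).const_mul m).add ((dθ i t).sub (dz i t))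
      refine cmp_abs 1 0 T one_pos _ _ _ _ (fun t => (dq i t).sub (dq j t))
        (fun t => ((hP t).add (hasDerivAt_cexp (η / 2) (4 * κ) t)).sub_const (2 * m * κ)) ?_ ?_
      · simp only [Pi.add_apply, Pi.sub_apply, hP0, hi0, hi1, zi0, sub_self, add_zero, mul_zero, Real.exp_zero, mul_one]
        rw [← mul_sub, abs_mul, abs_of_pos hm]
        have := mul_le_mul_of_nonneg_left (hDle i j) hm.le
        rw [hA]; linarith
      · intro t ht htT
        simp only [one_mul, zero_mul, add_zero]
        have h1 := hSlip t _ (h t ht htT)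
        have h2 := abs4 _ _ _ (h1 i) (h1 j)
        have h3 : (m * deriv (deriv (θm i)) t + (deriv (θm i) t - deriv (θz i) t))
          - (m * deriv (deriv (θm j)) t + (deriv (θm j) t - deriv (θz j) t))
          = (S θm i t - S θz i t) - (S θm j t - S θz j t) := by
          linear_combination hodem i t ht - hodem j t ht - hodez i t ht + hodez j t ht
        rw [h3]
        linarith
    intro t ht htT i j
    refine cmp_abs m 1 T hm (fun t => (θm i t - θz i t) - (θm j t - θz j t)) _ _ _
      (fun t => ((dθ i t).sub (dz i t)).sub ((dθ j t).sub (dz j t)))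
      (fun t => (hX t).add (hasDerivAt_cexp (η / 2) (4 * κ) t)) ?_ ?_ t ht htT
    · simp only [Pi.add_apply, hX0, hi0, zi0, sub_self, abs_zero, mul_zero, Real.exp_zero, mul_one]
      linarith
    · intro t ht htT
      simp only [Pi.add_apply]
      have h1 := hq i j t ht htT
      have h2 := abs4 _ _ _ (hS θz i t) (hS θz j t)
      have h3 : m * (deriv (θm i) t - deriv (θz i) t - (deriv (θm j) t - deriv (θz j) t))
          + 1 * ((θm i t - θz i t) - (θm j t - θz j t))
        = ((m * (deriv (θm i) t - ν i) + (θm i t - θz i t))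
          - (m * (deriv (θm j) t - ν j) + (θm j t - θz j t)))
          - m * (S θz i t - S θz j t) := by
        linear_combination - m * hodez i t ht + m * hodez j t ht
      rw [h3]
      refine (abs_sub _ _).trans ?_
      rw [abs_mul, abs_of_pos hm]
      have h4 := mul_le_mul_of_nonneg_left h2 hm.le
      have h5 := hXP t
      have h6 : 0 ≤ m * (η / 2 * (4 * κ * Real.exp (4 * κ * t))) := by positivity
      linarith
  have main : ∀ t, 0 ≤ t → ∀ i j, |(θm i t - θz i t) - (θm j t - θz j t)| ≤ X t := by
    intro T hT i j
    have hcont : Continuous (fun t => (fun i => θm i t - θz i t : Fin N → ℝ)) :=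
      continuous_pi (fun i => (hc i).continuous.sub (zc i).continuous)
    obtain ⟨K, hK⟩ := (isCompact_Icc (a := (0 : ℝ)) (b := T)).exists_bound_of_continuousOn
      hcont.continuousOn
    have hK0 : 0 ≤ K := (norm_nonneg _).trans (hK 0 ⟨le_rfl, hT⟩)
    have all : ∀ n : ℕ, ∀ t, 0 ≤ t → t ≤ T → ∀ i j, |(θm i t - θz i t) - (θm j t - θz j t)|
        ≤ X t + (2 * K * (1 / 2) ^ n) * Real.exp (4 * κ * t) := by
      intro n
      induction n with
      | zero =>
        intro t ht htT i j
        have h1 := hK t ⟨ht, htT⟩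
        have h2 := fun i => (norm_le_pi_norm (fun i => θm i t - θz i t : Fin N → ℝ) i).trans h1
        have h3 := abs4 _ _ _ (h2 i) (h2 j)
        have h4 : 1 ≤ Real.exp (4 * κ * t) := Real.one_le_exp (by positivity)
        have h5 := hXnn t ht
        simp only [pow_zero, mul_one]
        nlinarith
      | succ n ih =>
        have := step T _ (by positivity) ih
        intro t ht htT i j
        refine (this t ht htT i j).trans (le_of_eq ?_)
        rw [pow_succ]; ring
    have hlim : Tendsto (fun n : ℕ => X T + (2 * K * (1 / 2) ^ n) * Real.exp (4 * κ * T)) atTop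
        (𝓝 (X T + (2 * K * 0) * Real.exp (4 * κ * T))) := by
      refine Tendsto.const_add _ (Tendsto.mul_const _ (Tendsto.const_mul _ ?_))
      exact tendsto_pow_atTop_nhds_zero_of_lt_one (by norm_num) (by norm_num)
    have := ge_of_tendsto' hlim (fun n => all n T hT le_rfl i j)
    simpa using this
  -- final step
  intro T hT i j
  obtain ⟨e, he⟩ : ∃ e : ℝ, e = 4 * m * κ * A / (r * (1 + r)) := ⟨_, rfl⟩
  have he0 : 0 ≤ e := by rw [he]; positivity
  have hee : e * (m * l + 1) = 2 * κ * c := by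
    rw [hlr, he, hcdef]; field_simp; ring
  have du : ∀ i t, HasDerivAt (fun t => deriv (θm i) t - ν i - S θz i t)
      (deriv (deriv (θm i)) t - (κ / N) * ∑ j, Real.cos (θz j t - θz i t) * (deriv (θz j) t - deriv (θz i) t)) t :=
    fun i t => ((dω i t).sub_const (ν i)).sub (hSd i t)
  have hSd' : ∀ t, 0 ≤ t → ∀ i, |(κ / N) * ∑ j, Real.cos (θz j t - θz i t) * (deriv (θz j) t - deriv (θz i) t)| ≤ κ * B := by
    intro t ht i
    refine avg_bound N hN κ hκ _ B (fun j => ?_)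
    rw [abs_mul]
    have h1 := hzdiff t ht j i
    have h2 := Real.abs_cos_le_one (θz j t - θz i t)
    nlinarith [abs_nonneg (deriv (θz j) t - deriv (θz i) t)]
  have dG : ∀ t, HasDerivAt (fun t => (A - 2 * m * κ * B) * Real.exp (-(1 / m) * t) + e * Real.exp (l * t)
        + 2 * m * κ * B)
      ((A - 2 * m * κ * B) * (-(1 / m) * Real.exp (-(1 / m) * t)) + e * (l * Real.exp (l * t))) t := fun t =>
    ((hasDerivAt_cexp _ _ t).add (hasDerivAt_cexp _ _ t)).add_const _
  have fin := cmp_abs m 1 T hm _ _ _ _ (fun t => (du i t).sub (du j t)) dG ?_ ?_ T hT le_rfl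
  · have e1 : (deriv (θm i) T - deriv (θz i) T) - (deriv (θm j) T - deriv (θz j) T)
        = (deriv (θm i) T - ν i - S θz i T) - (deriv (θm j) T - ν j - S θz j T) := by
      linear_combination - hodez i T hT + hodez j T hT
    have e2 : Real.exp (-T / m) = Real.exp (-(1 / m) * T) := by congr 1; ring
    have e3 : Real.exp ((-1 + r) * T / (2 * m)) = Real.exp (l * T) := by
      congr 1; rw [hl]; ring
    rw [e1, e2, e3, ← he]
    refine le_trans fin (le_of_eq ?_)
    ring
  · simp only [Pi.sub_apply, hi1, mul_zero, Real.exp_zero, mul_one]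
    have h1 := abs4 _ _ _ (hS θz i 0) (hS θz j 0)
    have h2 := hDle i j
    have h3 : (ω0 i - ν i - S θz i 0) - (ω0 j - ν j - S θz j 0)
      = ((ω0 i - ν i) - (ω0 j - ν j)) - (S θz i 0 - S θz j 0) := by ring
    rw [h3]
    refine (abs_sub _ _).trans ?_
    rw [hA]; linarith
  · intro t ht htT
    simp only [Pi.sub_apply]
    have h1 := hSlip t _ (main t ht)
    have h2 := abs4 _ _ _ (h1 i) (h1 j)
    have h3 := abs4 _ _ _ (hSd' t ht i) (hSd' t ht j)
    generalize (κ / N) * ∑ k, Real.cos (θz k t - θz i t) * (deriv (θz k) t - deriv (θz i) t) = gi at h3 ⊢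
    generalize (κ / N) * ∑ k, Real.cos (θz k t - θz j t) * (deriv (θz k) t - deriv (θz j) t) = gj at h3 ⊢
    have h4 : m * ((deriv (deriv (θm i)) t - gi) - (deriv (deriv (θm j)) t - gj))
        + 1 * ((deriv (θm i) t - ν i - S θz i t) - (deriv (θm j) t - ν j - S θz j t))
        = ((S θm i t - S θz i t) - (S θm j t - S θz j t)) - m * (gi - gj) := by
      linear_combination hodem i t ht - hodem j t ht
    rw [h4]
    refine (abs_sub _ _).trans ?_
    rw [abs_mul, abs_of_pos hm]
    have h5 := mul_le_mul_of_nonneg_left h3 hm.le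
    have h6 : m * ((A - 2 * m * κ * B) * (-(1 / m) * Real.exp (-(1 / m) * t)) + e * (l * Real.exp (l * t)))
        + 1 * ((A - 2 * m * κ * B) * Real.exp (-(1 / m) * t) + e * Real.exp (l * t) + 2 * m * κ * B)
        = e * (m * l + 1) * Real.exp (l * t) + 2 * m * κ * B := by
      have : m * (1 / m) = 1 := by field_simp
      linear_combination (-(A - 2 * m * κ * B) * Real.exp (-(1 / m) * t)) * this
    rw [h6, hee]
    have h7 : X t ≤ c * Real.exp (l * t) := by
      have := Real.exp_pos (μ * t)
      simp only [X]; nlinarith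
    have h8 := mul_le_mul_of_nonneg_left h7 hκ.le
    linarith
end
end

section
/- Fix N ≥ 1, κ, m, t₀ > 0 with t₀ < max{1/(2κ), √(m/κ)}, natural frequencies ν₁,…,ν_N ∈ ℝ, a vector Ω⁰ = (ω₁⁰,…,ω_N⁰) ∈ ℝ^N, and a point Θ*(t₀) ∈ ℝ^N. Then there exists exactly one initial position vector Θ⁰ ∈ ℝ^N such that the global solution (θ₁,…,θ_N) of the inertial Kuramoto model with inertia m, coupling strength κ, natural frequencies ν₁,…,ν_N, and initial data (Θ⁰, Ω⁰) satisfies (θ₁(t₀),…,θ_N(t₀)) = Θ*(t₀). -/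
open Filter Topology MeasureTheory intervalIntegral

noncomputable section

namespace Kura

/-- Global existence for a smooth globally Lipschitz autonomous vector field. -/
theorem global_exists {E : Type*} [NormedAddCommGroup E] [NormedSpace ℝ E] [CompleteSpace E]
    (v : E → E) (hv : ContDiff ℝ 1 v) (K : NNReal) (hK : LipschitzWith K v) (x : E) :
    ∃ γ : ℝ → E, γ 0 = x ∧ ∀ t, HasDerivAt γ (v (γ t)) t := by
  have hε : (0:ℝ) < 1 / (2 * (K + 1)) := by positivity
  have key : ∀ x : E, ∃ γ : ℝ → E, γ 0 = x ∧
      IsMIntegralCurveOn (I := modelWithCornersSelf ℝ E) γ v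
        (Set.Ioo (-(1 / (2 * ((K:ℝ) + 1)))) (1 / (2 * (K + 1)))) := by
    intro x
    set ε : ℝ := 1 / (2 * ((K:ℝ) + 1)) with hεdef
    let a : NNReal := ‖v x‖₊
    have hpl : IsPicardLindelof (fun _ => v) (tmin := -ε) (tmax := ε)
        ⟨0, by constructor <;> linarith⟩ x a 0 (‖v x‖₊ + K * a) K := by
      apply IsPicardLindelof.of_time_independent
      · intro y hy
        have h1 := hK.dist_le_mul y x
        rw [Metric.mem_closedBall] at hy
        have h2 : ‖v y‖ ≤ ‖v x‖ + dist (v y) (v x) := by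
          rw [dist_eq_norm]
          have := norm_add_le (v x) (v y - v x)
          simpa using this
        have h3 : (K:ℝ) * dist y x ≤ K * a := by gcongr
        have h4 : ((‖v x‖₊ + K * a : NNReal) : ℝ) = ‖v x‖ + K * a := by push_cast; rfl
        rw [h4]
        linarith
      · exact hK.lipschitzOnWith
      · simp only [a, NNReal.coe_add, NNReal.coe_mul, coe_nnnorm, NNReal.coe_zero, sub_zero,
          zero_sub, neg_neg, max_self]
        have : (‖v x‖ + K * ‖v x‖) * ε = ‖v x‖ / 2 := by
          rw [hεdef]; field_simp; ring
        rw [this]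
        have := norm_nonneg (v x)
        linarith
    obtain ⟨α, h0, hα⟩ := hpl.exists_eq_forall_mem_Icc_hasDerivWithinAt₀
    refine ⟨α, h0, fun t ht => ?_⟩
    have := (hα t (Set.Ioo_subset_Icc_self ht)).mono Set.Ioo_subset_Icc_self
    exact this.hasFDerivWithinAt.hasMFDerivWithinAt
  obtain ⟨γ, h0, hγ⟩ := exists_isMIntegralCurve_of_isMIntegralCurveOn
    (I := modelWithCornersSelf ℝ E) (v := v)
    (contMDiff_vectorSpace_iff_contDiff.2 hv) hε key x
  refine ⟨γ, h0, fun t => ?_⟩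
  have := (hγ t).hasFDerivAt
  rw [hasDerivAt_iff_hasFDerivAt]
  exact this

theorem smooth_of_ode {E : Type*} [NormedAddCommGroup E] [NormedSpace ℝ E]
    (v : E → E) (hv : ContDiff ℝ (⊤ : ℕ∞) v) (γ : ℝ → E)
    (hγ : ∀ t, HasDerivAt γ (v (γ t)) t) : ContDiff ℝ (⊤ : ℕ∞) γ := by
  rw [contDiff_infty]
  intro n
  induction n with
  | zero =>
    exact contDiff_zero.2 (continuous_iff_continuousAt.2 fun t => (hγ t).continuousAt)
  | succ n ih =>
    push_cast
    rw [contDiff_succ_iff_deriv]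
    refine ⟨fun t => (hγ t).differentiableAt, by simp, ?_⟩
    have : deriv γ = v ∘ γ := funext fun t => (hγ t).deriv
    rw [this]
    exact (hv.of_le (by exact_mod_cast le_top)).comp ih

/-- The force term. -/
def kF (N : ℕ) (κ : ℝ) (ν x : Fin N → ℝ) (i : Fin N) : ℝ :=
  ν i + (κ / N) * ∑ j, Real.sin (x j - x i)

theorem abs_sin_sub_le (a b : ℝ) : |Real.sin a - Real.sin b| ≤ |a - b| := by
  have := Real.lipschitzWith_sin.dist_le_mul a b
  simpa [Real.dist_eq] using this

theorem kF_lip (N : ℕ) (hN : 1 ≤ N) (κ : ℝ) (hκ : 0 < κ) (ν x y : Fin N → ℝ) (D : ℝ)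
    (h : ∀ j, |x j - y j| ≤ D) (i : Fin N) :
    |kF N κ ν x i - kF N κ ν y i| ≤ 2 * κ * D := by
  have e : kF N κ ν x i - kF N κ ν y i
      = (κ / N) * ∑ j, (Real.sin (x j - x i) - Real.sin (y j - y i)) := by
    unfold kF; rw [Finset.sum_sub_distrib]; ring
  have hN' : (0:ℝ) < N := by exact_mod_cast hN
  rw [e, abs_mul, abs_of_pos (by positivity)]
  have : |∑ j, (Real.sin (x j - x i) - Real.sin (y j - y i))| ≤ ∑ j : Fin N, 2 * D := by
    refine (Finset.abs_sum_le_sum_abs _ _).trans (Finset.sum_le_sum fun j _ => ?_)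
    refine (abs_sin_sub_le _ _).trans ?_
    have h1 := h j
    have h2 := h i
    rw [abs_le] at *
    constructor <;> linarith [h1.1, h1.2, h2.1, h2.2]
  calc κ / N * |∑ j, (Real.sin (x j - x i) - Real.sin (y j - y i))|
      ≤ κ / N * ∑ j : Fin N, 2 * D := by gcongr
    _ = 2 * κ * D := by simp; field_simp

theorem kF_contDiff (N : ℕ) (κ : ℝ) (ν : Fin N → ℝ) (i : Fin N) :
    ContDiff ℝ (⊤ : ℕ∞) (fun x : Fin N → ℝ => kF N κ ν x i) := by
  unfold kF
  fun_prop

/-- Monotone comparison. -/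
theorem compare (d w B b : ℝ → ℝ) (T : ℝ)
    (hd : ∀ s ∈ Set.Icc 0 T, HasDerivAt d (w s) s) (hB : ∀ s, HasDerivAt B (b s) s)
    (hb : ∀ s ∈ Set.Icc 0 T, |w s| ≤ b s) (s t : ℝ) (hs : 0 ≤ s) (hst : s ≤ t) (ht : t ≤ T) :
    |d t - d s| ≤ B t - B s := by
  have hs' : s ∈ Set.Icc 0 T := ⟨hs, hst.trans ht⟩
  have ht' : t ∈ Set.Icc 0 T := ⟨hs.trans hst, ht⟩
  have m1 : MonotoneOn (fun s => B s - d s) (Set.Icc 0 T) := by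
    apply monotoneOn_of_hasDerivWithinAt_nonneg (f' := fun s => b s - w s) (convex_Icc _ _)
    · exact fun s hs => ((hB s).sub (hd s hs)).continuousAt.continuousWithinAt
    · exact fun s hs => ((hB s).sub (hd s (interior_subset hs))).hasDerivWithinAt
    · intro s hs
      have := (abs_le.1 (hb s (interior_subset hs))).2
      linarith
  have m2 : MonotoneOn (fun s => B s + d s) (Set.Icc 0 T) := by
    apply monotoneOn_of_hasDerivWithinAt_nonneg (f' := fun s => b s + w s) (convex_Icc _ _)
    · exact fun s hs => ((hB s).add (hd s hs)).continuousAt.continuousWithinAt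
    · exact fun s hs => ((hB s).add (hd s (interior_subset hs))).hasDerivWithinAt
    · intro s hs
      have := (abs_le.1 (hb s (interior_subset hs))).1
      linarith
  have h1 := m1 hs' ht' hst
  have h2 := m2 hs' ht' hst
  simp only at h1 h2
  rw [abs_le]
  constructor <;> linarith

theorem vel_bound (m C T : ℝ) (hm : 0 < m) (w g : ℝ → ℝ) (hw0 : w 0 = 0)
    (hw : ∀ s ∈ Set.Icc 0 T, HasDerivAt w ((g s - w s) / m) s)
    (hg : ∀ s ∈ Set.Icc 0 T, |g s| ≤ C) (s : ℝ) (hs : s ∈ Set.Icc 0 T) :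
    |w s| ≤ C * (1 - Real.exp (-(s / m))) := by
  have he : ∀ s, HasDerivAt (fun s => Real.exp (s / m)) (Real.exp (s / m) * (1 / m)) s :=
    fun s => ((hasDerivAt_id s).div_const m).exp
  have h := compare (fun s => Real.exp (s / m) * w s)
    (fun s => Real.exp (s / m) * g s / m) (fun s => C * Real.exp (s / m))
    (fun s => C * (Real.exp (s / m) * (1 / m))) T
    (fun s hs => by
      refine ((he s).mul (hw s hs)).congr_deriv ?_
      field_simp
      ring)
    (fun s => (he s).const_mul C)
    (fun s hs => by
      rw [abs_div, abs_mul, abs_of_pos hm, abs_of_pos (Real.exp_pos _)]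
      calc Real.exp (s / m) * |g s| / m ≤ Real.exp (s / m) * C / m := by
            gcongr; exact hg s hs
        _ = _ := by ring) 0 s le_rfl hs.1 hs.2
  simp only [hw0, mul_zero, sub_zero, zero_div, Real.exp_zero, mul_one] at h
  rw [abs_mul, abs_of_pos (Real.exp_pos _)] at h
  have hp := Real.exp_pos (s / m)
  have e : C * (1 - Real.exp (-(s / m))) = (C * Real.exp (s / m) - C) / Real.exp (s / m) := by
    rw [Real.exp_neg]; field_simp
  rw [e, le_div_iff₀ hp]
  linarith

theorem pos_bound (m C T κ D : ℝ) (hm : 0 < m) (hκ : 0 < κ) (hT : 0 < T) (hD : 0 ≤ D)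
    (d w g : ℝ → ℝ) (hw0 : w 0 = 0)
    (hd : ∀ s ∈ Set.Icc 0 T, HasDerivAt d (w s) s)
    (hw : ∀ s ∈ Set.Icc 0 T, HasDerivAt w ((g s - w s) / m) s)
    (hg : ∀ s ∈ Set.Icc 0 T, |g s| ≤ 2 * κ * D)
    (hC : C = 2 * κ * min T (T ^ 2 / (2 * m))) (t : ℝ) (ht : t ∈ Set.Icc 0 T) :
    |d t - d T| ≤ C * D := by
  have hv := vel_bound m _ T hm w g hw0 hw hg
  have hKD : 0 ≤ 2 * κ * D := by positivity
  have h1 := compare d w (fun s => 2 * κ * D * s) (fun _ => 2 * κ * D) T hd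
    (fun s => by simpa using (hasDerivAt_id s).const_mul (2 * κ * D))
    (fun s hs => (hv s hs).trans (by
      have := (Real.exp_pos (-(s / m))).le
      nlinarith)) t T ht.1 ht.2 le_rfl
  have h2 := compare d w (fun s => 2 * κ * D * (s ^ 2 / (2 * m))) (fun s => 2 * κ * D * (s / m)) T hd
    (fun s => by
      refine (((hasDerivAt_pow 2 s).div_const (2 * m)).const_mul (2 * κ * D)).congr_deriv ?_
      norm_num
      field_simp
      simp)
    (fun s hs => (hv s hs).trans (by
      have := Real.add_one_le_exp (-(s / m))
      gcongr
      linarith)) t T ht.1 ht.2 le_rfl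
  rw [abs_sub_comm] at h1 h2
  have e1 : 0 ≤ 2 * κ * D * t := mul_nonneg hKD ht.1
  have e2 : 0 ≤ 2 * κ * D * (t ^ 2 / (2 * m)) := by positivity
  rw [hC]
  rcases min_choice T (T ^ 2 / (2 * m)) with h | h <;> rw [h]
  · linarith
  · linarith

theorem const_lt (κ m T : ℝ) (hκ : 0 < κ) (hm : 0 < m) (hT : 0 < T)
    (h : T < max (1 / (2 * κ)) (Real.sqrt (m / κ))) :
    2 * κ * min T (T ^ 2 / (2 * m)) < 1 := by
  rcases lt_max_iff.1 h with h | h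
  · rw [lt_div_iff₀ (by positivity)] at h
    have := min_le_left T (T ^ 2 / (2 * m))
    nlinarith
  · rw [Real.lt_sqrt hT.le, lt_div_iff₀ hκ] at h
    have := min_le_right T (T ^ 2 / (2 * m))
    calc 2 * κ * min T (T ^ 2 / (2 * m)) ≤ 2 * κ * (T ^ 2 / (2 * m)) := by gcongr
      _ = (T ^ 2 * κ) / m := by field_simp
      _ < 1 := by rw [div_lt_one hm]; exact h

theorem lin_solve (m w0 p T : ℝ) (hm : 0 < m) (g : ℝ → ℝ) (hg : Continuous g) :
    ∃ d w : ℝ → ℝ, w 0 = w0 ∧ d T = p ∧ (∀ s, HasDerivAt d (w s) s) ∧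
      ∀ s, HasDerivAt w ((g s - w s) / m) s := by
  let w : ℝ → ℝ := fun t => Real.exp (-(t / m)) *
    (w0 + ∫ s in (0:ℝ)..t, Real.exp (s / m) * g s / m)
  have hc : Continuous (fun s => Real.exp (s / m) * g s / m) := by fun_prop
  have hw : ∀ s, HasDerivAt w ((g s - w s) / m) s := by
    intro t
    have h1 : HasDerivAt (fun t => Real.exp (-(t / m))) (Real.exp (-(t / m)) * (-(1 / m))) t :=
      (((hasDerivAt_id t).div_const m).neg).exp
    have h2 : HasDerivAt (fun t => w0 + ∫ s in (0:ℝ)..t, Real.exp (s / m) * g s / m)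
        (Real.exp (t / m) * g t / m) t :=
      (hc.integral_hasStrictDerivAt 0 t).hasDerivAt.const_add w0
    refine (h1.mul h2).congr_deriv ?_
    have e : Real.exp (-(t / m)) * Real.exp (t / m) = 1 := by
      rw [← Real.exp_add]; simp
    have e2 : Real.exp (-(t / m)) * (Real.exp (t / m) * g t / m) = g t / m := by
      calc _ = (Real.exp (-(t / m)) * Real.exp (t / m)) * (g t / m) := by ring
        _ = _ := by rw [e, one_mul]
    rw [e2]
    simp only [w]
    ring
  have hwc : Continuous w := continuous_iff_continuousAt.2 fun t => (hw t).continuousAt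
  refine ⟨fun t => p + ∫ s in T..t, w s, w, by simp [w], by simp, fun t => ?_, hw⟩
  exact (hwc.integral_hasStrictDerivAt T t).hasDerivAt.const_add p

/-- The phase-space vector field. -/
def kV (N : ℕ) (κ m : ℝ) (ν : Fin N → ℝ) (p : (Fin N → ℝ) × (Fin N → ℝ)) :
    (Fin N → ℝ) × (Fin N → ℝ) :=
  (p.2, fun i => (kF N κ ν p.1 i - p.2 i) / m)

theorem kV_contDiff (N : ℕ) (κ m : ℝ) (ν : Fin N → ℝ) :
    ContDiff ℝ (⊤ : ℕ∞) (kV N κ m ν) := by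
  unfold kV
  refine contDiff_snd.prodMk (contDiff_pi.2 fun i => ?_)
  have h1 := (kF_contDiff N κ ν i).comp
    (contDiff_fst (𝕜 := ℝ) (E := Fin N → ℝ) (F := Fin N → ℝ))
  have h2 : ContDiff ℝ (⊤ : ℕ∞) (fun p : (Fin N → ℝ) × (Fin N → ℝ) => p.2 i) := by fun_prop
  exact (h1.sub h2).div_const m

theorem kV_lip (N : ℕ) (hN : 1 ≤ N) (κ m : ℝ) (hκ : 0 < κ) (hm : 0 < m) (ν : Fin N → ℝ) :
    LipschitzWith (Real.toNNReal (1 + (2 * κ + 1) / m)) (kV N κ m ν) := by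
  apply LipschitzWith.of_dist_le_mul
  intro p q
  rw [Real.coe_toNNReal _ (by positivity)]
  have hD : 0 ≤ dist p q := dist_nonneg
  have h1 : ∀ j, |p.1 j - q.1 j| ≤ dist p q := fun j =>
    (dist_le_pi_dist p.1 q.1 j).trans (le_max_left _ _)
  have h2 : ∀ j, |p.2 j - q.2 j| ≤ dist p q := fun j =>
    (dist_le_pi_dist p.2 q.2 j).trans (le_max_right _ _)
  have hc : 0 ≤ (2 * κ + 1) / m := by positivity
  rw [Prod.dist_eq]
  refine max_le ?_ ?_
  · have : dist p.2 q.2 ≤ dist p q := le_max_right _ _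
    simp only [kV]
    nlinarith
  · rw [dist_pi_le_iff (by positivity)]
    intro i
    have hk := kF_lip N hN κ hκ ν p.1 q.1 _ h1 i
    have h2i := h2 i
    simp only [kV, Real.dist_eq]
    rw [← sub_div, abs_div, abs_of_pos hm]
    have : |kF N κ ν p.1 i - p.2 i - (kF N κ ν q.1 i - q.2 i)| ≤ (2 * κ + 1) * dist p q := by
      rw [abs_le] at *
      constructor <;> linarith [hk.1, hk.2, h2i.1, h2i.2]
    calc _ ≤ (2 * κ + 1) * dist p q / m := by gcongr
      _ = (2 * κ + 1) / m * dist p q := by ring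
      _ ≤ _ := by nlinarith

/-- Curves solving the two-point problem. -/
theorem exists_curve (N : ℕ) (hN : 1 ≤ N) (κ m T : ℝ)
    (hκ : 0 < κ) (hm : 0 < m) (hT : 0 < T)
    (hT' : T < max (1 / (2 * κ)) (Real.sqrt (m / κ)))
    (ν ω0 θstar : Fin N → ℝ) :
    ∃ y : ℝ → (Fin N → ℝ) × (Fin N → ℝ), (y 0).2 = ω0 ∧ (y T).1 = θstar ∧
      ∀ t ∈ Set.Icc 0 T, HasDerivAt y (kV N κ m ν (y t)) t := by
  let ex : C(Set.Icc (0:ℝ) T, Fin N → ℝ) → ℝ → Fin N → ℝ :=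
    fun x t => x (Set.projIcc 0 T hT.le t)
  have hex : ∀ x, Continuous (ex x) := fun x => x.continuous.comp continuous_projIcc
  have hg : ∀ x i, Continuous (fun s => kF N κ ν (ex x s) i) := fun x i =>
    (kF_contDiff N κ ν i).continuous.comp (hex x)
  choose d w hw0 hdT hd hw using fun x i =>
    lin_solve m (ω0 i) (θstar i) T hm (fun s => kF N κ ν (ex x s) i) (hg x i)
  have hdc : ∀ x i, Continuous (d x i) := fun x i =>
    continuous_iff_continuousAt.2 fun t => (hd x i t).continuousAt
  let Op : C(Set.Icc (0:ℝ) T, Fin N → ℝ) → C(Set.Icc (0:ℝ) T, Fin N → ℝ) := fun x =>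
    ⟨fun t i => d x i t, continuous_pi fun i => (hdc x i).comp continuous_subtype_val⟩
  set C : ℝ := 2 * κ * min T (T ^ 2 / (2 * m)) with hC
  have hC1 : C < 1 := const_lt κ m T hκ hm hT hT'
  have hC0 : 0 ≤ C := by
    have : 0 ≤ min T (T ^ 2 / (2 * m)) := le_min hT.le (by positivity)
    positivity
  have hcon : ContractingWith (Real.toNNReal C) Op := by
    refine ⟨by rw [← NNReal.coe_lt_coe, Real.coe_toNNReal _ hC0]; exact_mod_cast hC1, ?_⟩
    apply LipschitzWith.of_dist_le_mul
    intro x z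
    rw [Real.coe_toNNReal _ hC0]
    have hD : 0 ≤ dist x z := dist_nonneg
    rw [ContinuousMap.dist_le (by positivity)]
    intro t
    rw [dist_pi_le_iff (by positivity)]
    intro i
    have := pos_bound m C T κ (dist x z) hm hκ hT hD (fun s => d x i s - d z i s)
      (fun s => w x i s - w z i s)
      (fun s => kF N κ ν (ex x s) i - kF N κ ν (ex z s) i)
      (by simp [hw0]) (fun s _ => (hd x i s).sub (hd z i s))
      (fun s _ => ((hw x i s).sub (hw z i s)).congr_deriv (by ring))
      (fun s _ => kF_lip N hN κ hκ ν _ _ _ (fun j =>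
        (dist_le_pi_dist (ex x s) (ex z s) j).trans (ContinuousMap.dist_apply_le_dist _)) i)
      hC t t.2
    simpa [hdT, Op, Real.dist_eq] using this
  have hfix := hcon.fixedPoint_isFixedPt
  set x := ContractingWith.fixedPoint Op hcon
  have hx : ∀ t ∈ Set.Icc 0 T, ex x t = fun i => d x i t := by
    intro t ht
    have h1 : ex x t = x ⟨t, ht⟩ := by
      simp only [ex]; rw [Set.projIcc_of_mem _ ht]
    have h2 : Op x ⟨t, ht⟩ = x ⟨t, ht⟩ := by rw [hfix]
    rw [h1, ← h2]
    rfl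
  refine ⟨fun t => (fun i => d x i t, fun i => w x i t), funext fun i => hw0 x i,
    funext fun i => hdT x i, fun t ht => ?_⟩
  refine HasDerivAt.prodMk (hasDerivAt_pi.2 fun i => hd x i t) (hasDerivAt_pi.2 fun i => ?_)
  have := hw x i t
  rw [hx t ht] at this
  exact this

theorem exists_sol (N : ℕ) (hN : 1 ≤ N) (κ m T : ℝ)
    (hκ : 0 < κ) (hm : 0 < m) (hT : 0 < T)
    (hT' : T < max (1 / (2 * κ)) (Real.sqrt (m / κ)))
    (ν ω0 θstar : Fin N → ℝ) :
    ∃ θ0 : Fin N → ℝ, ∃ θ : Fin N → ℝ → ℝ,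
      IsInertialSol N m κ ν θ0 ω0 θ ∧ ∀ i, θ i T = θstar i := by
  obtain ⟨y, hy0, hyT, hy⟩ := exists_curve N hN κ m T hκ hm hT hT' ν ω0 θstar
  have hsm := kV_contDiff N κ m ν
  have hl := kV_lip N hN κ m hκ hm ν
  obtain ⟨γ, h0, hγ⟩ := global_exists (kV N κ m ν) (hsm.of_le (by exact_mod_cast le_top)) _ hl (y 0)
  have hγs := smooth_of_ode _ hsm γ hγ
  have heq := ODE_solution_unique (v := fun _ => kV N κ m ν) (f := γ) (g := y) (a := 0) (b := T)
    (fun _ => hl) (fun t _ => (hγ t).continuousAt.continuousWithinAt)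
    (fun t _ => (hγ t).hasDerivWithinAt)
    (fun t ht => (hy t ht).continuousAt.continuousWithinAt)
    (fun t ht => (hy t (Set.Ico_subset_Icc_self ht)).hasDerivWithinAt) h0
  have hd1 : ∀ i t, HasDerivAt (fun t => (γ t).1 i) ((γ t).2 i) t := fun i t =>
    hasDerivAt_pi.1 (hγ t).fst i
  have hd2 : ∀ i t, HasDerivAt (fun t => (γ t).2 i) ((kF N κ ν (γ t).1 i - (γ t).2 i) / m) t :=
    fun i t => hasDerivAt_pi.1 (hγ t).snd i
  have e1 : ∀ i, deriv (fun t => (γ t).1 i) = fun t => (γ t).2 i := fun i =>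
    funext fun t => (hd1 i t).deriv
  refine ⟨(y 0).1, fun i t => (γ t).1 i, ⟨fun i => ?_, fun i => ?_, fun i => ?_, fun i t _ => ?_⟩,
    fun i => ?_⟩
  · exact contDiff_pi.1 (contDiff_fst.comp hγs) i
  · simp only [h0]
  · rw [e1]
    simp only [h0, hy0]
  · rw [e1, (hd2 i t).deriv]
    simp only [kF]
    field_simp
    ring
  · simp only [heq ⟨hT.le, le_rfl⟩, hyT]

theorem sol_unique (N : ℕ) (hN : 1 ≤ N) (κ m T : ℝ)
    (hκ : 0 < κ) (hm : 0 < m) (hT : 0 < T)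
    (hT' : T < max (1 / (2 * κ)) (Real.sqrt (m / κ)))
    (ν ω0 θ0 θ1 : Fin N → ℝ) (θ φ : Fin N → ℝ → ℝ)
    (hθ : IsInertialSol N m κ ν θ0 ω0 θ) (hφ : IsInertialSol N m κ ν θ1 ω0 φ)
    (hend : ∀ i, θ i T = φ i T) : θ0 = θ1 := by
  have key : ∀ (η : Fin N → ℝ) (ψ : Fin N → ℝ → ℝ), IsInertialSol N m κ ν η ω0 ψ →
      (∀ i s, HasDerivAt (ψ i) (deriv (ψ i) s) s) ∧
      ∀ i, ∀ s ∈ Set.Icc 0 T, HasDerivAt (deriv (ψ i))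
        ((kF N κ ν (fun j => ψ j s) i - deriv (ψ i) s) / m) s := by
    intro η ψ h
    have hd := fun i => contDiff_infty_iff_deriv.1 (h.1 i)
    refine ⟨fun i s => ((hd i).1 s).hasDerivAt, fun i s hs => ?_⟩
    have h2 := ((contDiff_infty_iff_deriv.1 (hd i).2).1 s).hasDerivAt
    refine h2.congr_deriv ?_
    have := h.2.2.2 i s hs.1
    rw [eq_div_iff hm.ne']
    simp only [kF]
    linarith
  obtain ⟨a1, a2⟩ := key _ _ hθ
  obtain ⟨b1, b2⟩ := key _ _ hφ
  let X : C(Set.Icc (0:ℝ) T, Fin N → ℝ) := ⟨fun t i => θ i t,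
    continuous_pi fun i => (hθ.1 i).continuous.comp continuous_subtype_val⟩
  let Y : C(Set.Icc (0:ℝ) T, Fin N → ℝ) := ⟨fun t i => φ i t,
    continuous_pi fun i => (hφ.1 i).continuous.comp continuous_subtype_val⟩
  set C : ℝ := 2 * κ * min T (T ^ 2 / (2 * m)) with hC
  have hC1 : C < 1 := const_lt κ m T hκ hm hT hT'
  have hC0 : 0 ≤ C := by
    have : 0 ≤ min T (T ^ 2 / (2 * m)) := le_min hT.le (by positivity)
    positivity
  have hD : 0 ≤ dist X Y := dist_nonneg
  have hXY : ∀ s ∈ Set.Icc 0 T, ∀ j, |θ j s - φ j s| ≤ dist X Y := fun s hs j =>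
    (dist_le_pi_dist (X ⟨s, hs⟩) (Y ⟨s, hs⟩) j).trans (ContinuousMap.dist_apply_le_dist _)
  have hle : dist X Y ≤ C * dist X Y := by
    rw [ContinuousMap.dist_le (by positivity)]
    intro t
    rw [dist_pi_le_iff (by positivity)]
    intro i
    have := pos_bound m C T κ (dist X Y) hm hκ hT hD (fun s => θ i s - φ i s)
      (fun s => deriv (θ i) s - deriv (φ i) s)
      (fun s => kF N κ ν (fun j => θ j s) i - kF N κ ν (fun j => φ j s) i)
      (by simp [hθ.2.2.1, hφ.2.2.1]) (fun s _ => (a1 i s).sub (b1 i s))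
      (fun s hs => ((a2 i s hs).sub (b2 i s hs)).congr_deriv (by ring))
      (fun s hs => kF_lip N hN κ hκ ν _ _ _ (hXY s hs) i)
      hC t t.2
    simpa [hend, X, Y, Real.dist_eq] using this
  have h0 : dist X Y = 0 := by nlinarith
  funext i
  have := hXY 0 ⟨le_rfl, hT.le⟩ i
  rw [h0, hθ.2.1, hφ.2.1] at this
  exact sub_eq_zero.1 (abs_nonpos_iff.1 this)

end Kura

/-- Proposition 5.1 (3): for `t₀ < max{1/(2κ), √(m/κ)}` there is a unique initial
position vector `Θ⁰` whose solution with velocity data `Ω⁰` passes through `Θ*(t₀)`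
at time `t₀`. -/
theorem stmt12 (N : ℕ) (hN : 1 ≤ N) (κ m t₀ : ℝ)
    (hκ : 0 < κ) (hm : 0 < m) (ht₀ : 0 < t₀)
    (ht₀' : t₀ < max (1 / (2 * κ)) (Real.sqrt (m / κ)))
    (ν ω0 θstar : Fin N → ℝ) :
    ∃! θ0 : Fin N → ℝ, ∃ θ : Fin N → ℝ → ℝ,
      IsInertialSol N m κ ν θ0 ω0 θ ∧ ∀ i, θ i t₀ = θstar i := by
  obtain ⟨θ0, θ, hθ, hT⟩ := Kura.exists_sol N hN κ m t₀ hκ hm ht₀ ht₀' ν ω0 θstar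
  refine ⟨θ0, ⟨θ, hθ, hT⟩, ?_⟩
  rintro θ1 ⟨φ, hφ, hT1⟩
  exact Kura.sol_unique N hN κ m t₀ hκ hm ht₀ ht₀' ν ω0 θ1 θ0 φ θ hφ hθ
    (fun i => (hT1 i).trans (hT i).symm)
end
end

section
/- Let κ, m, t* > 0 with mκ > 1/4 and t* > πm/√(4mκ−1) + (2m/√(4mκ−1)) · arcsin(1/√(4mκ)), and let N ≥ 2. Then there exist natural frequencies ν₁,…,ν_N ∈ ℝ and two sets of initial data (Θ⁰, Θ̇⁰) and (Φ⁰, Φ̇⁰) in ℝ^N × ℝ^N such that, denoting by θ₁,…,θ_N and φ₁,…,φ_N the corresponding global solutions of the inertial Kuramoto model with inertia m, coupling strength κ, and natural frequencies ν₁,…,ν_N, one has θ̇ᵢ(0) = φ̇ᵢ(0) for all i and θᵢ(t*) = φᵢ(t*) for all i, yet θ̇ᵢ(t*) ≠ φ̇ᵢ(t*) for some i. -/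
open Filter Topology MeasureTheory intervalIntegral

noncomputable section

open scoped Manifold ContDiff NNReal in
theorem aux_global {E : Type*} [NormedAddCommGroup E] [NormedSpace ℝ E] [CompleteSpace E]
    (F : E → E) (hF : ContDiff ℝ 1 F) (K : ℝ≥0) (hK : LipschitzWith K F) (x : E) :
    ∃ X : ℝ → E, X 0 = x ∧ ∀ t, HasDerivAt X (F (X t)) t := by
  have key := exists_isMIntegralCurve_of_isMIntegralCurveOn (I := 𝓘(ℝ, E)) (M := E) (v := F)
    (contMDiff_vectorSpace_iff_contDiff.2 hF) (ε := 1 / (1 + (K : ℝ))) (by positivity) ?_ x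
  · obtain ⟨X, h0, hX⟩ := key
    refine ⟨X, h0, fun t => ?_⟩
    have this : HasFDerivAt X ((1 : ℝ →L[ℝ] ℝ).smulRight (F (X t))) t :=
      hasMFDerivAt_iff_hasFDerivAt.1 (hX t)
    exact this.hasDerivAt.congr_deriv (by simp)
  · intro x
    set ε : ℝ := 1 / (1 + (K : ℝ)) with hε
    have hε0 : 0 < ε := by positivity
    have hPL : IsPicardLindelof (tmin := -ε) (tmax := ε) (fun _ => F)
        ⟨0, by constructor <;> linarith⟩ x (‖F x‖₊ + 1) 0
        ((1 + K) * (‖F x‖₊ + 1)) K := by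
      apply IsPicardLindelof.of_time_independent
      · intro y hy
        have h1 := hK.dist_le_mul y x
        rw [Metric.mem_closedBall] at hy
        have h2 : ‖F y‖ ≤ ‖F x‖ + dist (F y) (F x) := by
          rw [dist_eq_norm]
          have := norm_add_le (F x) (F y - F x)
          simpa using this
        have h3 : (K : ℝ) * dist y x ≤ K * ((‖F x‖₊ + 1 : ℝ≥0) : ℝ) := by gcongr
        push_cast at h3 ⊢
        nlinarith
      · exact hK.lipschitzOnWith
      · simp only [sub_zero, zero_sub, neg_neg, max_self]
        push_cast
        rw [hε]
        have : (1 + (K:ℝ)) ≠ 0 := by positivity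
        field_simp
        simp
    obtain ⟨α, h0, hα⟩ := hPL.exists_eq_forall_mem_Icc_hasDerivWithinAt₀
    refine ⟨α, h0, fun t ht => ?_⟩
    apply HasMFDerivAt.hasMFDerivWithinAt
    apply hasMFDerivAt_iff_hasFDerivAt.2
    exact ((hα t ⟨ht.1.le, ht.2.le⟩).hasDerivAt (Icc_mem_nhds ht.1 ht.2)).hasFDerivAt

open scoped ContDiff in
theorem aux_smooth {E : Type*} [NormedAddCommGroup E] [NormedSpace ℝ E]
    (F : E → E) (hF : ContDiff ℝ ∞ F) (X : ℝ → E) (hX : ∀ t, HasDerivAt X (F (X t)) t) :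
    ContDiff ℝ ∞ X := by
  rw [contDiff_infty]
  intro n
  induction n with
  | zero => 
    exact contDiff_zero.2 (continuous_iff_continuousAt.2 fun t => (hX t).continuousAt)
  | succ n ih =>
    have : deriv X = fun t => F (X t) := funext fun t => (hX t).deriv
    push_cast
    rw [contDiff_succ_iff_deriv]
    refine ⟨fun t => (hX t).differentiableAt, fun h => ?_, ?_⟩
    · exact absurd h (by simp)
    · rw [this]
      exact (contDiff_infty.1 hF n).comp ih

theorem aux_sin (x u : ℝ) : |Real.sin (x + u) - Real.sin x - Real.cos x * u| ≤ u ^ 2 := by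
  have h := Convex.norm_image_sub_le_of_norm_hasDerivWithin_le
    (f := fun u => Real.sin (x + u) - Real.sin x - Real.cos x * u)
    (f' := fun u => Real.cos (x + u) - Real.cos x) (s := Set.uIcc 0 u) (x := 0) (y := u)
    (C := |u|) ?_ ?_ (convex_uIcc 0 u) Set.left_mem_uIcc Set.right_mem_uIcc
  · simp only [Real.norm_eq_abs, sub_zero, mul_zero, add_zero, sub_self] at h
    calc _ ≤ _ := h
      _ = u ^ 2 := by rw [← sq, sq_abs]
  · intro w _
    have h1 : HasDerivAt (fun u => x + u) 1 w := (hasDerivAt_id w).const_add x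
    have h2 := ((h1.sin.sub_const (Real.sin x)).sub ((hasDerivAt_id w).const_mul (Real.cos x)))
    exact (h2.congr_deriv (by simp)).hasDerivWithinAt
  · intro w hw
    have h3 : |w| ≤ |u| := by
      have := Set.abs_sub_left_of_mem_uIcc hw
      simpa using this
    refine le_trans ?_ h3
    have := Real.abs_cos_sub_cos_le (x + w) x
    simpa using this

theorem aux_lip (m κ : ℝ) (hm : 0 < m) (hκ : 0 < κ) (g : ℝ → ℝ)
    (hg : ∀ a b, |g a - g b| ≤ κ * |a - b|) :
    LipschitzWith (1 + (1 + κ) / m).toNNReal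
      (fun X : ℝ × ℝ => ((X.2, (X.2 + g X.1) / m) : ℝ × ℝ)) := by
  apply LipschitzWith.of_dist_le_mul
  intro X Y
  rw [Real.coe_toNNReal _ (by positivity), Prod.dist_eq, Prod.dist_eq]
  set D := max (dist X.1 Y.1) (dist X.2 Y.2) with hD
  have h1 : |X.1 - Y.1| ≤ D := le_max_left _ _
  have h2 : |X.2 - Y.2| ≤ D := le_max_right _ _
  have hD0 : 0 ≤ D := (abs_nonneg _).trans h1
  have hp : 0 ≤ (1 + κ) / m := by positivity
  apply max_le
  · rw [Real.dist_eq]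
    nlinarith
  · rw [Real.dist_eq]
    have : (X.2 + g X.1) / m - (Y.2 + g Y.1) / m = ((X.2 - Y.2) + (g X.1 - g Y.1)) / m := by ring
    rw [this, abs_div, abs_of_pos hm]
    have h3 : |(X.2 - Y.2) + (g X.1 - g Y.1)| ≤ (1 + κ) * D := by
      have := abs_add_le (X.2 - Y.2) (g X.1 - g Y.1)
      have := hg X.1 Y.1
      nlinarith
    calc _ ≤ (1 + κ) * D / m := by gcongr
      _ ≤ _ := by
        have : (1 + κ) * D / m = (1 + κ) / m * D := by ring
        rw [this]; nlinarith

theorem aux_linear (m ω k : ℝ) (hm : 0 < m) (hω : 0 < ω)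
    (hk : 4 * m * k = 1 + (2 * m * ω) ^ 2) (t : ℝ) :
    HasDerivAt (fun s : ℝ => ((Real.exp (s / (2 * m)) * (Real.sin (ω * s) / ω),
      Real.exp (s / (2 * m)) * (Real.sin (ω * s) / (2 * m * ω) + Real.cos (ω * s))) : ℝ × ℝ))
      (Real.exp (t / (2 * m)) * (Real.sin (ω * t) / (2 * m * ω) + Real.cos (ω * t)),
        (Real.exp (t / (2 * m)) * (Real.sin (ω * t) / (2 * m * ω) + Real.cos (ω * t))
          + -(k * (Real.exp (t / (2 * m)) * (Real.sin (ω * t) / ω)))) / m) t := by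
  have hk' : k = (1 + (2 * m * ω) ^ 2) / (4 * m) := by field_simp; linarith
  have he : HasDerivAt (fun s : ℝ => Real.exp (s / (2 * m)))
      (Real.exp (t / (2 * m)) * (1 / (2 * m))) t := ((hasDerivAt_id t).div_const (2 * m)).exp
  have hl : HasDerivAt (fun s : ℝ => ω * s) ω t := by
    simpa using (hasDerivAt_id t).const_mul ω
  have h1 := he.mul (hl.sin.div_const ω)
  have h2 := he.mul ((hl.sin.div_const (2 * m * ω)).add hl.cos)
  refine (h1.prodMk h2).congr_deriv ?_
  ext
  · simp only
    field_simp
  · simp only [hk']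
    simp
    field_simp
    ring

theorem aux_scalar (m κ T xs ω : ℝ) (hm : 0 < m) (hκ : 0 < κ) (hT : 0 < T) (hω : 0 < ω)
    (hk : 4 * m * (κ * Real.cos xs) = 1 + (2 * m * ω) ^ 2)
    (hneg : Real.sin (ω * T) / (2 * m * ω) + Real.cos (ω * T) < 0) :
    ∃ (p : ℝ) (X : ℝ → ℝ × ℝ), 0 < p ∧ X 0 = (xs, p) ∧ (X T).2 = 0 ∧
      ∀ t, HasDerivAt X ((X t).2, ((X t).2 + (κ * Real.sin xs - κ * Real.sin (X t).1)) / m) t := by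
  set F : ℝ × ℝ → ℝ × ℝ := fun X => (X.2, (X.2 + (κ * Real.sin xs - κ * Real.sin X.1)) / m)
    with hF
  set K := (1 + (1 + κ) / m).toNNReal with hKdef
  have hKr : (K : ℝ) = 1 + (1 + κ) / m := Real.coe_toNNReal _ (by positivity)
  have hK0 : (0 : ℝ) < K := by rw [hKr]; positivity
  have hFL : LipschitzWith K F := by
    apply aux_lip m κ hm hκ (fun a => κ * Real.sin xs - κ * Real.sin a)
    intro a b
    have : κ * Real.sin xs - κ * Real.sin a - (κ * Real.sin xs - κ * Real.sin b)
      = κ * (Real.sin b - Real.sin a) := by ring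
    rw [this, abs_mul, abs_of_pos hκ, abs_sub_comm a b]
    have := Real.abs_sin_sub_sin_le b a
    gcongr
  have hFC : ContDiff ℝ 1 F := by
    rw [hF]
    fun_prop
  have hex : ∀ p : ℝ, ∃ X : ℝ → ℝ × ℝ, X 0 = (xs, p) ∧ ∀ t, HasDerivAt X (F (X t)) t :=
    fun p => aux_global F hFC K hFL (xs, p)
  choose X hX0 hX using hex
  have hXc : ∀ p, Continuous (X p) := fun p =>
    continuous_iff_continuousAt.2 fun t => (hX p t).continuousAt
  set B := Real.exp (K * T) with hB
  have hB0 : 0 < B := Real.exp_pos _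
  -- continuity in the parameter
  have hdist : ∀ p q, |(X p T).2 - (X q T).2| ≤ |p - q| * B := by
    intro p q
    have := dist_le_of_trajectories_ODE (v := fun _ => F) (K := K) (f := X p) (g := X q)
      (a := 0) (b := T) (δ := |p - q|) (fun _ => hFL) (hXc p).continuousOn
      (fun t _ => (hX p t).hasDerivWithinAt) (hXc q).continuousOn
      (fun t _ => (hX q t).hasDerivWithinAt)
      (by rw [hX0, hX0, Prod.dist_eq]; simp [Real.dist_eq]) T ⟨hT.le, le_rfl⟩
    rw [sub_zero] at this
    refine le_trans ?_ this
    rw [Prod.dist_eq]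
    exact le_max_right _ _
  have hcont : Continuous (fun p => (X p T).2) := by
    apply LipschitzWith.continuous (K := B.toNNReal)
    apply LipschitzWith.of_dist_le_mul
    intro p q
    rw [Real.coe_toNNReal _ hB0.le, Real.dist_eq, Real.dist_eq, mul_comm]
    exact hdist p q
  -- large parameter
  have hlarge : 0 < (X (2 * κ + 1) T).2 := by
    set Y := X (2 * κ + 1) with hY
    have hd : ∀ t, HasDerivAt (fun s => Real.exp (-s / m) * ((Y s).2 - 2 * κ))
        (Real.exp (-t / m) * ((2 * κ + (κ * Real.sin xs - κ * Real.sin (Y t).1)) / m)) t := by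
      intro t
      have h2 : HasDerivAt (fun s => (Y s).2) (F (Y t)).2 t := (hX (2 * κ + 1) t).snd
      have he : HasDerivAt (fun s : ℝ => Real.exp (-s / m))
        (Real.exp (-t / m) * (-1 / m)) t := ((hasDerivAt_id t).neg.div_const m).exp
      refine (he.mul (h2.sub_const (2 * κ))).congr_deriv ?_
      simp only [hF]
      field_simp
      ring
    have hmono : Monotone (fun s => Real.exp (-s / m) * ((Y s).2 - 2 * κ)) := by
      apply monotone_of_deriv_nonneg (fun t => (hd t).differentiableAt)
      intro t
      rw [(hd t).deriv]
      have h1 := Real.neg_one_le_sin xs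
      have h2 := Real.sin_le_one (Y t).1
      have : 0 ≤ 2 * κ + (κ * Real.sin xs - κ * Real.sin (Y t).1) := by nlinarith
      positivity
    have h := hmono hT.le
    have h0 : (Y 0).2 = 2 * κ + 1 := by rw [hY, hX0]
    simp only [h0, neg_zero, zero_div, Real.exp_zero] at h
    have hpos : 0 < Real.exp (-T / m) := Real.exp_pos _
    by_contra hcon
    push Not at hcon
    nlinarith
  -- small parameter
  have hsmall : ∃ p, 0 < p ∧ (X p T).2 < 0 := by
    set Z : ℝ → ℝ × ℝ := fun s : ℝ => ((Real.exp (s / (2 * m)) * (Real.sin (ω * s) / ω),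
      Real.exp (s / (2 * m)) * (Real.sin (ω * s) / (2 * m * ω) + Real.cos (ω * s))) : ℝ × ℝ) with hZ
    have hZT : (Z T).2 < 0 := mul_neg_of_pos_of_neg (Real.exp_pos _) hneg
    set A : ℝ × ℝ → ℝ × ℝ := fun X => (X.2, (X.2 + -(κ * Real.cos xs * X.1)) / m) with hA
    have hAL : LipschitzWith K A := by
      apply aux_lip m κ hm hκ (fun a => -(κ * Real.cos xs * a))
      intro a b
      have : -(κ * Real.cos xs * a) - -(κ * Real.cos xs * b) = κ * (Real.cos xs * (b - a)) := by
        ring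
      rw [this, abs_mul, abs_of_pos hκ, abs_sub_comm a b, abs_mul]
      have := Real.abs_cos_le_one xs
      have := abs_nonneg (b - a)
      gcongr
      nlinarith
    have hZd : ∀ t, HasDerivAt Z (A (Z t)) t := fun t =>
      aux_linear m ω (κ * Real.cos xs) hm hω hk t
    have hZc : Continuous Z := continuous_iff_continuousAt.2 fun t => (hZd t).continuousAt
    have hZ0 : Z 0 = (0, 1) := by simp [hZ]
    set C := κ / m * B ^ 2 / K * (B - 1) with hC
    have hB1 : 1 ≤ B := Real.one_le_exp (by positivity)
    have hC0 : 0 ≤ C := by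
      have : 0 ≤ B - 1 := by linarith
      positivity
    have hest : ∀ p, 0 < p → |(X p T).2 - p * (Z T).2| ≤ C * p ^ 2 := by
      intro p hp
      have hu : ∀ t ∈ Set.Icc 0 T, |(X p t).1 - xs| ≤ p * B := by
        intro t ht
        have := dist_le_of_trajectories_ODE (v := fun _ => F) (K := K) (f := X p)
          (g := fun _ => (xs, 0))
          (a := 0) (b := T) (δ := p) (fun _ => hFL) (hXc p).continuousOn
          (fun t _ => (hX p t).hasDerivWithinAt) continuousOn_const
          (fun t _ => by
            have : F (xs, 0) = 0 := by simp [hF]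
            rw [this]; exact hasDerivWithinAt_const _ _ _)
          (by rw [hX0, Prod.dist_eq]; simp [abs_of_pos hp, hp.le]) t ht
        rw [sub_zero] at this
        calc |(X p t).1 - xs| ≤ _ := le_max_left _ _
          _ ≤ _ := this
          _ ≤ p * B := by
            rw [hB]
            have := ht.2
            gcongr
      have := dist_le_of_approx_trajectories_ODE (v := fun _ => A) (K := K)
        (f := fun t => X p t - (xs, 0)) (g := fun t => p • Z t) (f' := fun t => F (X p t))
        (g' := fun t => p • A (Z t)) (a := 0) (b := T) (δ := 0) (εf := κ / m * (p * B) ^ 2)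
        (εg := 0) (fun _ => hAL) ((hXc p).sub continuous_const).continuousOn
        (fun t _ => ((hX p t).sub_const _).hasDerivWithinAt) ?_
        (hZc.const_smul p).continuousOn (fun t _ => ((hZd t).const_smul p).hasDerivWithinAt)
        ?_ ?_ T ⟨hT.le, le_rfl⟩
      · rw [gronwallBound_of_K_ne_0 hK0.ne', sub_zero] at this
        calc |(X p T).2 - p * (Z T).2| ≤ dist (X p T - (xs, 0)) (p • Z T) := by
              rw [Prod.dist_eq, Real.dist_eq, Real.dist_eq]
              refine le_trans (le_of_eq ?_) (le_max_right _ _)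
              simp
          _ ≤ _ := this
          _ = C * p ^ 2 := by rw [hC, hB]; ring
      · intro t ht
        have hut := hu t ⟨ht.1, ht.2.le⟩
        have hs := aux_sin xs ((X p t).1 - xs)
        rw [add_sub_cancel] at hs
        have hsq : ((X p t).1 - xs) ^ 2 ≤ (p * B) ^ 2 := by
          rw [← sq_abs]; gcongr
        rw [Prod.dist_eq, Real.dist_eq, Real.dist_eq]
        apply max_le
        · simp [hF, hA]; positivity
        · simp only [hF, hA, Prod.fst_sub, Prod.snd_sub, sub_zero]
          have : ((X p t).2 + (κ * Real.sin xs - κ * Real.sin (X p t).1)) / m -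
              ((X p t).2 + -(κ * Real.cos xs * ((X p t).1 - xs))) / m
              = -(κ / m * (Real.sin (X p t).1 - Real.sin xs
                - Real.cos xs * ((X p t).1 - xs))) := by ring
          rw [this, abs_neg, abs_mul, abs_of_pos (by positivity)]
          gcongr
          exact hs.trans hsq
      · intro t _
        have : p • A (Z t) = A (p • Z t) := by
          ext
          · simp [hA]
          · simp [hA]; ring
        rw [this, dist_self]
      · rw [hX0, hZ0]; simp
    refine ⟨-(Z T).2 / (C + 1), div_pos (by linarith) (by linarith), ?_⟩
    set p := -(Z T).2 / (C + 1) with hp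
    have hp0 : 0 < p := div_pos (by linarith) (by linarith)
    have hpe : p * (C + 1) = -(Z T).2 := by rw [hp]; field_simp
    have h := (abs_le.1 (hest p hp0)).2
    nlinarith
  obtain ⟨p, hp, hpn⟩ := hsmall
  have hiv := intermediate_value_uIcc (f := fun p => (X p T).2) (a := p) (b := 2 * κ + 1)
    hcont.continuousOn
  obtain ⟨q, hq, hq0⟩ := hiv (Set.mem_uIcc.2 (Or.inl ⟨hpn.le, hlarge.le⟩) : (0 : ℝ) ∈ _)
  refine ⟨q, X q, ?_, hX0 q, hq0, hX q⟩
  rcases Set.mem_uIcc.1 hq with h | h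
  · linarith [h.1]
  · linarith [h.1]

theorem aux_cluster (N : ℕ) (hN : 2 ≤ N) (m κ c : ℝ) (x : ℝ → ℝ)
    (hx : ContDiff ℝ (⊤ : ℕ∞) x)
    (hode : ∀ t, m * deriv (deriv x) t + deriv x t = c - κ * Real.sin (x t))
    (i₀ : Fin N) (a : Fin N → ℝ) (ha : ∀ i, a i = (if i = i₀ then 1 else 0) - 1 / (N : ℝ)) :
    IsInertialSol N m κ (fun i => a i * c) (fun i => a i * x 0) (fun i => a i * deriv x 0)
      (fun i t => a i * x t) := by
  have hN0 : (N : ℝ) ≠ 0 := by positivity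
  have hd : ∀ i, deriv (fun t => a i * x t) = fun t => a i * deriv x t := by
    intro i
    funext t
    simp
  refine ⟨fun i => contDiff_const.mul hx, fun i => rfl, fun i => by rw [hd], ?_⟩
  intro i t _
  rw [hd]
  have h2 : deriv (fun t => a i * deriv x t) t = a i * deriv (deriv x) t := by
    simp
  rw [h2]
  have hsum : ∑ j, Real.sin (a j * x t - a i * x t) = -(N * a i) * Real.sin (x t) := by
    by_cases hi : i = i₀
    · have : ∀ j, Real.sin (a j * x t - a i * x t)
          = -Real.sin (x t) - (if j = i₀ then -Real.sin (x t) else 0) := by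
        intro j
        rw [ha j, ha i, hi]
        by_cases hj : j = i₀
        · simp [hj]
        · have : ((if j = i₀ then (1 : ℝ) else 0) - 1 / N) * x t
            - ((if i₀ = i₀ then (1 : ℝ) else 0) - 1 / N) * x t = -x t := by
            simp [hj]; ring
          rw [this]; simp [hj]
      rw [Finset.sum_congr rfl fun j _ => this j, ha i]
      simp [hi, Finset.sum_sub_distrib]
      field_simp
      ring
    · have : ∀ j, Real.sin (a j * x t - a i * x t)
          = (if j = i₀ then Real.sin (x t) else 0) := by
        intro j
        rw [ha j, ha i]
        by_cases hj : j = i₀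
        · have : ((if j = i₀ then (1 : ℝ) else 0) - 1 / N) * x t
            - ((if i = i₀ then (1 : ℝ) else 0) - 1 / N) * x t = x t := by
            simp [hj, hi]; ring
          rw [this]; simp [hj]
        · simp [hj, hi]
      rw [Finset.sum_congr rfl fun j _ => this j, ha i]
      simp [hi]
      field_simp
  rw [hsum]
  have := hode t
  have h3 : κ / N * (-(N * a i) * Real.sin (x t)) = -(a i * (κ * Real.sin (x t))) := by
    field_simp
  rw [h3]
  linear_combination a i * this

theorem aux_choose (κ m T : ℝ) (hκ : 0 < κ) (hm : 0 < m) (hT : 0 < T)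
    (hmκ : 1 / 4 < m * κ)
    (ht : Real.pi * m / Real.sqrt (4 * m * κ - 1) +
        2 * m / Real.sqrt (4 * m * κ - 1) * Real.arcsin (1 / Real.sqrt (4 * m * κ)) < T) :
    ∃ xs ω : ℝ, 0 < ω ∧ 4 * m * (κ * Real.cos xs) = 1 + (2 * m * ω) ^ 2 ∧
      Real.sin (ω * T) / (2 * m * ω) + Real.cos (ω * T) < 0 := by
  set r := Real.sqrt (4 * m * κ - 1) with hr
  set R := Real.sqrt (4 * m * κ) with hR
  have hr0 : 0 < r := Real.sqrt_pos.2 (by linarith)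
  have hr2 : r ^ 2 = 4 * m * κ - 1 := Real.sq_sqrt (by linarith)
  have hR0 : 0 < R := Real.sqrt_pos.2 (by positivity)
  have hR2 : R ^ 2 = 4 * m * κ := Real.sq_sqrt (by positivity)
  have hR1 : 1 < R := by nlinarith
  have hpi := Real.pi_pos
  by_cases hc : r / (2 * m) * T ≤ Real.pi
  · refine ⟨0, r / (2 * m), by positivity, ?_, ?_⟩
    · have : 2 * m * (r / (2 * m)) = r := by field_simp
      rw [this, hr2, Real.cos_zero]; ring
    · set ω := r / (2 * m) with hω
      have h2 : 2 * m * ω = r := by rw [hω]; field_simp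
      rw [h2]
      set α := Real.arcsin (1 / R) with hα
      have hlt : Real.pi / 2 + α < ω * T := by
        have : Real.pi / 2 + α = ω * (Real.pi * m / r + 2 * m / r * α) := by
          rw [hω]; field_simp
        rw [this]
        exact mul_lt_mul_of_pos_left ht (by positivity)
      have hsin : Real.sin α = 1 / R := by
        apply Real.sin_arcsin
        · have : 0 < 1 / R := by positivity
          linarith
        · rw [div_le_one hR0]; exact hR1.le
      have hcos : Real.cos α = r / R := by
        rw [hα, Real.cos_arcsin]
        rw [Real.sqrt_eq_iff_mul_self_eq (by
          rw [div_pow, one_pow, sub_nonneg, div_le_one (by positivity)]; nlinarith) (by positivity)]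
        field_simp
        nlinarith
      have hα0 : 0 ≤ α := Real.arcsin_nonneg.2 (by positivity)
      have hneg : Real.cos (ω * T - α) < 0 := by
        apply Real.cos_neg_of_pi_div_two_lt_of_lt <;> linarith
      rw [Real.cos_sub, hsin, hcos] at hneg
      have : Real.sin (ω * T) / r + Real.cos (ω * T)
        = R / r * (Real.cos (ω * T) * (r / R) + Real.sin (ω * T) * (1 / R)) := by
        field_simp; ring
      rw [this]
      exact mul_neg_of_pos_of_neg (by positivity) hneg
  · push Not at hc
    have hω0 : 0 < Real.pi / T := by positivity
    have hωr : 2 * m * (Real.pi / T) < r := by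
      have : r / (2 * m) * T = r * T / (2 * m) := by ring
      rw [this, lt_div_iff₀ (by positivity)] at hc
      rw [← mul_div_assoc, div_lt_iff₀ hT]
      linarith
    set ω := Real.pi / T with hω
    have hωT : ω * T = Real.pi := by rw [hω]; field_simp
    refine ⟨Real.arccos ((1 + (2 * m * ω) ^ 2) / (4 * m * κ)), ω, hω0, ?_, ?_⟩
    · rw [Real.cos_arccos]
      · field_simp
      · have : 0 < (1 + (2 * m * ω) ^ 2) / (4 * m * κ) := by positivity
        linarith
      · rw [div_le_one (by positivity)]
        have : (2 * m * ω) ^ 2 ≤ r ^ 2 := by gcongr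
        linarith
    · rw [hωT]; simp

/-- Proposition 5.2 (2): beyond the critical time in the regime `mκ > 1/4`,
`θ̇(t*)` is not determined by `θ(t*)` and `θ̇(0)`. -/
theorem stmt14 (κ m tstar : ℝ) (hκ : 0 < κ) (hm : 0 < m) (htstar : 0 < tstar)
    (hmκ : 1 / 4 < m * κ)
    (ht : Real.pi * m / Real.sqrt (4 * m * κ - 1) +
        2 * m / Real.sqrt (4 * m * κ - 1) * Real.arcsin (1 / Real.sqrt (4 * m * κ))
      < tstar)
    (N : ℕ) (hN : 2 ≤ N) :
    ∃ (ν θ0 ω0 φ0 ψ0 : Fin N → ℝ) (θ φ : Fin N → ℝ → ℝ),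
      IsInertialSol N m κ ν θ0 ω0 θ ∧
      IsInertialSol N m κ ν φ0 ψ0 φ ∧
      (∀ i, deriv (θ i) 0 = deriv (φ i) 0) ∧
      (∀ i, θ i tstar = φ i tstar) ∧
      ∃ i, deriv (θ i) tstar ≠ deriv (φ i) tstar := by
  
  obtain ⟨xs, ω, hω, hk, hneg⟩ := aux_choose κ m tstar hκ hm htstar hmκ ht
  obtain ⟨p, X, hp, hX0, hXT, hX⟩ := aux_scalar m κ tstar xs ω hm hκ htstar hω hk hneg
  have hXs : ContDiff ℝ (⊤ : ℕ∞) X := by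
    apply aux_smooth
      (fun X : ℝ × ℝ => (X.2, (X.2 + (κ * Real.sin xs - κ * Real.sin X.1)) / m)) _ X hX
    fun_prop
  set x : ℝ → ℝ := fun t => (X (tstar - t)).1 with hx
  have hxs : ContDiff ℝ (⊤ : ℕ∞) x :=
    (hXs.comp (contDiff_const.sub contDiff_id)).fst
  have hrev : ∀ t, HasDerivAt (fun t => tstar - t) (-1) t := fun t => by
    simpa using (hasDerivAt_id t).const_sub tstar
  have hx1 : ∀ t, HasDerivAt x (-(X (tstar - t)).2) t := by
    intro t
    have h : HasDerivAt (fun s => (X s).1) (X (tstar - t)).2 (tstar - t) := (hX (tstar - t)).fst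
    exact (h.comp t (hrev t)).congr_deriv (by ring)
  have hdx : deriv x = fun t => -(X (tstar - t)).2 := funext fun t => (hx1 t).deriv
  have hx2 : ∀ t, HasDerivAt (fun t => -(X (tstar - t)).2)
      (((X (tstar - t)).2 + (κ * Real.sin xs - κ * Real.sin (X (tstar - t)).1)) / m) t := by
    intro t
    have h : HasDerivAt (fun s => (X s).2)
        (((X (tstar - t)).2 + (κ * Real.sin xs - κ * Real.sin (X (tstar - t)).1)) / m)
        (tstar - t) := (hX (tstar - t)).snd
    exact (h.comp t (hrev t)).neg.congr_deriv (by ring)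
  have hode : ∀ t, m * deriv (deriv x) t + deriv x t = κ * Real.sin xs - κ * Real.sin (x t) := by
    intro t
    rw [hdx, (hx2 t).deriv]
    simp only [hx]
    field_simp
    ring
  have hx0 : deriv x 0 = 0 := by rw [hdx]; simp [hXT]
  have hxT : x tstar = xs := by simp [hx, hX0]
  have hxT' : deriv x tstar = -p := by rw [hdx]; simp [hX0]
  set i₀ : Fin N := ⟨0, by omega⟩ with hi₀
  set a : Fin N → ℝ := fun i => (if i = i₀ then 1 else 0) - 1 / (N : ℝ) with ha
  have hai : a i₀ ≠ 0 := by
    have h2 : (2 : ℝ) ≤ N := by exact_mod_cast hN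
    have : 1 / (N : ℝ) < 1 := by rw [div_lt_one (by linarith)]; linarith
    simp only [ha, if_true]
    linarith
  have h1 := aux_cluster N hN m κ (κ * Real.sin xs) x hxs hode i₀ a (fun _ => rfl)
  have h2 := aux_cluster N hN m κ (κ * Real.sin xs) (fun _ => xs) contDiff_const
    (by intro t; simp) i₀ a (fun _ => rfl)
  have hd : ∀ i t, deriv (fun t => a i * x t) t = a i * deriv x t := by
    intro i t; simp
  refine ⟨_, _, _, _, _, _, _, h1, h2, ?_, ?_, i₀, ?_⟩
  · intro i
    rw [hd, hx0]; simp
  · intro i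
    simp only [hxT]
  · rw [hd, hxT']
    simp [hai, hp.ne']
end
end
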